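/- arXiv:1011.0910 — 3 statements merged into one kernel-verified Lean document; each statement's English description precedes it below -/
import Mathlib

section
/- Let v, w ∈ BV(]a,b[). Then the product vw belongs to BV(]a,b[) and the Leibniz rule D(vw) = v* Dw + w* Dv holds in the sense of measures, where v* and w* denote the precise representatives v*(x) = (v(x⁺)+v(x⁻))/2 and w*(x) = (w(x⁺)+w(x⁻))/2. -/
open Set Filter MeasureTheory

section Mollification

open ContinuousLinearMap Topology
open scoped Convolution

theorem BoundedVariationOn.exists_abs_indicator_le {f : ℝ → ℝ} {s : Set ℝ} (hf : BoundedVariationOn f s) :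
    ∃ C, ∀ x, |s.indicator f x| ≤ C := by
  rcases s.eq_empty_or_nonempty with rfl | ⟨y, hy⟩
  · exact ⟨0, by simp⟩
  · refine ⟨(eVariationOn f s).toReal + |f y|, fun x => ?_⟩
    by_cases hx : x ∈ s
    swap
    · rw [indicator_of_notMem hx, abs_zero]
      positivity
    rw [indicator_of_mem hx]
    have h := hf.dist_le hx hy
    rw [Real.dist_eq] at h
    linarith [abs_sub_abs_le_abs_sub (f x) (f y)]

theorem BoundedVariationOn.aestronglyMeasurable_indicator {f : ℝ → ℝ} {s : Set ℝ}
    (hf : BoundedVariationOn f s) (hs : MeasurableSet s) (μ : Measure ℝ) :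
    AEStronglyMeasurable (s.indicator f) μ := by
  obtain ⟨p, q, hp, hq, rfl⟩ := hf.locallyBoundedVariationOn.exists_monotoneOn_sub_monotoneOn
  exact (aestronglyMeasurable_indicator_iff hs).2
    ((aemeasurable_restrict_of_monotoneOn hs hp).sub
      (aemeasurable_restrict_of_monotoneOn hs hq)).aestronglyMeasurable

theorem tendsto_indicator_nhdsWithin {f : ℝ → ℝ} {s t : Set ℝ} {x c : ℝ} (hs : s ∈ 𝓝 x)
    (hf : Tendsto f (𝓝[t] x) (𝓝 c)) : Tendsto (s.indicator f) (𝓝[t] x) (𝓝 c) :=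
  hf.congr' <| mem_of_superset (mem_nhdsWithin_of_mem_nhds hs) fun _ hy =>
    (indicator_of_mem hy f).symm

theorem integrable_of_abs_le_of_support_subset {f : ℝ → ℝ} {a b C : ℝ}
    (hf : AEStronglyMeasurable f volume) (hC : ∀ x, |f x| ≤ C)
    (hs : Function.support f ⊆ Ioo a b) : Integrable f :=
  (integrableOn_iff_integrable_of_support_subset hs).1 <|
    Measure.integrableOn_of_bounded (by simp) hf (Eventually.of_forall hC)

theorem ContDiffBump.abs_convolution_le (ρ : ContDiffBump (0 : ℝ)) {f : ℝ → ℝ} {C : ℝ}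
    (hC : ∀ x, |f x| ≤ C) (x : ℝ) :
    |(ρ.normed volume ⋆[lsmul ℝ ℝ, volume] f) x| ≤ C := by
  rw [convolution_def, ← Real.norm_eq_abs]
  have h : ∫ t, ρ.normed volume t * C = C := by
    rw [integral_mul_const, ρ.integral_normed, one_mul]
  rw [← h]
  refine norm_integral_le_of_norm_le (ρ.integrable_normed.mul_const C)
    (Eventually.of_forall fun t => ?_)
  simp only [lsmul_apply, smul_eq_mul, norm_mul, Real.norm_eq_abs,
    abs_of_nonneg (ρ.nonneg_normed t)]
  exact mul_le_mul_of_nonneg_left (hC _) (ρ.nonneg_normed t)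

theorem ContDiffBump.integrable_convolution_integrand (ρ : ContDiffBump (0 : ℝ)) {f : ℝ → ℝ}
    (hf : LocallyIntegrable f) (x : ℝ) :
    Integrable (fun t => ρ.normed volume t * f (x - t)) :=
  (ρ.hasCompactSupport_normed.convolutionExists_left (lsmul ℝ ℝ)
    ρ.continuous_normed hf x)

theorem ContDiffBump.convolution_eq_convolution_average (ρ : ContDiffBump (0 : ℝ)) {f : ℝ → ℝ}
    (hf : LocallyIntegrable f) (x : ℝ) :
    (ρ.normed volume ⋆[lsmul ℝ ℝ, volume] f) x =
      (ρ.normed volume ⋆[lsmul ℝ ℝ, volume] fun t => (f (x - t) + f (x + t)) / 2) 0 := by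
  simp only [convolution_def, lsmul_apply, smul_eq_mul, zero_sub, sub_neg_eq_add, ← sub_eq_add_neg]
  have hint := ρ.integrable_convolution_integrand hf x
  have h := integral_neg_eq_self (fun t => ρ.normed volume t * f (x - t)) volume
  have hint' := hint.comp_neg
  simp only [ρ.normed_neg, sub_neg_eq_add] at h hint'
  have hsplit : (fun t => ρ.normed volume t * ((f (x + t) + f (x - t)) / 2)) = fun t =>
      (ρ.normed volume t * f (x + t) + ρ.normed volume t * f (x - t)) / 2 := by
    ext t; ring
  rw [hsplit, integral_div, integral_add hint' hint, h]
  ring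

theorem ContDiffBump.tendsto_convolution_midpoint {ρ : ℕ → ContDiffBump (0 : ℝ)}
    (hρ : Tendsto (fun n => (ρ n).rOut) atTop (𝓝 0)) {f : ℝ → ℝ} (hf : LocallyIntegrable f)
    {x p m : ℝ} (hp : Tendsto f (𝓝[>] x) (𝓝 p)) (hm : Tendsto f (𝓝[<] x) (𝓝 m)) :
    Tendsto (fun n => ((ρ n).normed volume ⋆[lsmul ℝ ℝ, volume] f) x) atTop
      (𝓝 ((p + m) / 2)) := by
  set g : ℝ → ℝ := fun t => (f (x - t) + f (x + t)) / 2 with hg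
  have hgm : AEStronglyMeasurable g volume := by
    have h1 : AEStronglyMeasurable (fun t => f (x - t)) volume :=
      hf.aestronglyMeasurable.comp_measurePreserving (Measure.measurePreserving_sub_left volume x)
    have h2 : AEStronglyMeasurable (fun t => f (x + t)) volume :=
      hf.aestronglyMeasurable.comp_measurePreserving (measurePreserving_add_left volume x)
    simpa [hg, div_eq_mul_inv] using (h1.add h2).mul_const (2⁻¹ : ℝ)
  have hae : g =ᵐ[volume] Function.update g 0 ((p + m) / 2) := by
    filter_upwards [compl_mem_ae_iff.2 (measure_singleton (0 : ℝ))] with t ht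
    exact (Function.update_of_ne ht _ _).symm
  have hadd : ∀ s : Set ℝ, ∀ u : Set ℝ, (∀ t ∈ s, x + t ∈ u) →
      Tendsto (fun t => x + t) (𝓝[s] 0) (𝓝[u] x) := fun s u h =>
    tendsto_nhdsWithin_iff.2 ⟨((continuous_const_add x).tendsto' 0 x (by simp)).mono_left
      nhdsWithin_le_nhds, eventually_nhdsWithin_of_forall h⟩
  have hsub : ∀ s : Set ℝ, ∀ u : Set ℝ, (∀ t ∈ s, x - t ∈ u) →
      Tendsto (fun t => x - t) (𝓝[s] 0) (𝓝[u] x) := fun s u h =>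
    tendsto_nhdsWithin_iff.2 ⟨((continuous_const.sub continuous_id).tendsto' 0 x
      (by simp)).mono_left nhdsWithin_le_nhds, eventually_nhdsWithin_of_forall h⟩
  have hright : Tendsto g (𝓝[>] 0) (𝓝 ((p + m) / 2)) := by
    have h1 := hp.comp (hadd (Ioi 0) (Ioi x) (by simp))
    have h2 := hm.comp (hsub (Ioi 0) (Iio x) (by simp))
    simpa [hg, Function.comp_def, add_comm] using (h1.add h2).div_const 2
  have hleft : Tendsto g (𝓝[<] 0) (𝓝 ((p + m) / 2)) := by
    have h1 := hp.comp (hsub (Iio 0) (Ioi x) fun t (ht : t < 0) => show x < x - t by linarith)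
    have h2 := hm.comp (hadd (Iio 0) (Iio x) (by simp))
    simpa [hg, Function.comp_def, add_comm] using (h1.add h2).div_const 2
  have hne : Tendsto g (𝓝[≠] 0) (𝓝 ((p + m) / 2)) := by
    rw [← Iio_union_Ioi, nhdsWithin_union]
    exact hleft.sup hright
  have hcont : Tendsto (Function.update g 0 ((p + m) / 2)) (𝓝 0) (𝓝 ((p + m) / 2)) := by
    have h := (continuousAt_update_same (f := g) (x := (0 : ℝ)) (y := (p + m) / 2)).2 hne
    simpa [ContinuousAt] using h
  have key := ContDiffBump.convolution_tendsto_right (μ := volume) hρ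
    (g := fun _ => Function.update g 0 ((p + m) / 2))
    (Eventually.of_forall fun _ => hgm.congr hae)
    (hcont.comp tendsto_snd) (tendsto_const_nhds (x := (0 : ℝ)))
  refine key.congr fun n => ?_
  rw [(ρ n).convolution_eq_convolution_average hf x]
  exact congrFun (convolution_congr (lsmul ℝ ℝ) EventuallyEq.rfl hae.symm) 0

theorem integral_mul_convolution_of_odd {ψ F V : ℝ → ℝ} {M : ℝ} (hψ : Continuous ψ)
    (hM : ∀ x, ‖ψ x‖ ≤ M) (hodd : ∀ x, ψ (-x) = -ψ x) (hF : Integrable F) (hV : Integrable V) :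
    ∫ x, F x * (ψ ⋆[lsmul ℝ ℝ, volume] V) x = -∫ y, V y * (ψ ⋆[lsmul ℝ ℝ, volume] F) y := by
  simp only [convolution_eq_swap, lsmul_apply, smul_eq_mul, ← integral_const_mul]
  rw [integral_integral_swap, ← integral_neg]
  · refine integral_congr_ae (Eventually.of_forall fun y => ?_)
    simp only
    rw [← integral_neg]
    refine integral_congr_ae (Eventually.of_forall fun x => ?_)
    simp only
    rw [← neg_sub y x, hodd]
    ring
  · have h : Integrable (fun z : ℝ × ℝ => ψ (z.1 - z.2) * (F z.1 * V z.2))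
        (volume.prod volume) :=
      (hF.mul_prod hV).bdd_mul (c := M) (by fun_prop) (Eventually.of_forall fun z => hM _)
    refine h.congr (Eventually.of_forall fun z => ?_)
    simp only [Function.uncurry]
    ring

theorem ContDiffBump.deriv_normed_neg (ρ : ContDiffBump (0 : ℝ)) (x : ℝ) :
    deriv (ρ.normed volume) (-x) = -deriv (ρ.normed volume) x := by
  have h : (fun y => ρ.normed volume (-y)) = ρ.normed volume := funext ρ.normed_neg
  have h2 := deriv_comp_neg (ρ.normed volume) x
  rw [h] at h2
  rw [h2, neg_neg]

theorem ContDiffBump.contDiff_convolution (ρ : ContDiffBump (0 : ℝ)) {f : ℝ → ℝ}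
    (hf : LocallyIntegrable f) :
    ContDiff ℝ 1 (ρ.normed volume ⋆[lsmul ℝ ℝ, volume] f) :=
  ρ.hasCompactSupport_normed.contDiff_convolution_left (n := 1) _ ρ.contDiff_normed hf

theorem ContDiffBump.integral_mul_deriv_convolution (ρ : ContDiffBump (0 : ℝ)) {F V : ℝ → ℝ}
    (hF : Integrable F) (hV : Integrable V) :
    ∫ x, F x * deriv (ρ.normed volume ⋆[lsmul ℝ ℝ, volume] V) x =
      -∫ y, V y * deriv (ρ.normed volume ⋆[lsmul ℝ ℝ, volume] F) y := by
  have hd : ∀ f : ℝ → ℝ, Integrable f → deriv (ρ.normed volume ⋆[lsmul ℝ ℝ, volume] f) =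
      (deriv (ρ.normed volume) ⋆[lsmul ℝ ℝ, volume] f) := fun f hf => funext fun x =>
    (ρ.hasCompactSupport_normed.hasDerivAt_convolution_left (lsmul ℝ ℝ)
      (ρ.contDiff_normed (n := 1)) hf.locallyIntegrable x).deriv
  have hc : Continuous (deriv (ρ.normed volume)) :=
    (ρ.contDiff_normed (n := 1)).continuous_deriv le_rfl
  obtain ⟨M, hM⟩ := ρ.hasCompactSupport_normed.deriv.exists_bound_of_continuous hc
  rw [hd V hV, hd F hF]
  exact integral_mul_convolution_of_odd hc hM ρ.deriv_normed_neg hF hV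

theorem ContDiffBump.tsupport_convolution_subset (ρ : ContDiffBump (0 : ℝ)) {f : ℝ → ℝ}
    {K : Set ℝ} (hK : Function.support f ⊆ K) :
    tsupport (ρ.normed volume ⋆[lsmul ℝ ℝ, volume] f) ⊆ Metric.cthickening ρ.rOut K := by
  refine closure_minimal ?_ Metric.isClosed_cthickening
  refine (support_convolution_subset (lsmul ℝ ℝ)).trans ?_
  rw [ρ.support_normed_eq]
  rintro _ ⟨t, ht, y, hy, rfl⟩
  refine Metric.mem_cthickening_of_dist_le _ y _ _ (hK hy) ?_
  simpa [Real.dist_eq] using (mem_ball_zero_iff.1 ht).le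

theorem ContDiffBump.tendsto_integral_mul_convolution {μ : Measure ℝ}
    (ρ : ℕ → ContDiffBump (0 : ℝ)) {f h L : ℝ → ℝ} {C : ℝ} (hf : LocallyIntegrable f)
    (hC : ∀ x, |f x| ≤ C) (hh : Integrable h μ)
    (hlim : ∀ᵐ x ∂μ, h x ≠ 0 →
      Tendsto (fun n => ((ρ n).normed volume ⋆[lsmul ℝ ℝ, volume] f) x) atTop (𝓝 (L x))) :
    Tendsto (fun n => ∫ x, h x * ((ρ n).normed volume ⋆[lsmul ℝ ℝ, volume] f) x ∂μ) atTop
      (𝓝 (∫ x, h x * L x ∂μ)) := by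
  refine tendsto_integral_of_dominated_convergence (fun x => ‖h x‖ * C) (fun n => ?_)
    (hh.norm.mul_const C) (fun n => Eventually.of_forall fun x => ?_) ?_
  · exact hh.aestronglyMeasurable.mul
      ((ρ n).contDiff_convolution hf).continuous.aestronglyMeasurable
  · rw [norm_mul]
    exact mul_le_mul_of_nonneg_left ((ρ n).abs_convolution_le hC x) (norm_nonneg _)
  · filter_upwards [hlim] with x hx
    by_cases h0 : h x = 0
    · simp [h0]
    · exact (hx h0).const_mul _

theorem ContDiffBump.exists_tendsto_rOut_zero : ∃ ρ : ℕ → ContDiffBump (0 : ℝ),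
    Tendsto (fun n => (ρ n).rOut) atTop (𝓝 0) ∧ ∀ n, (ρ n).rOut ≤ 2 * (ρ n).rIn := by
  refine ⟨fun n => ⟨1 / (n + 1 : ℝ), 2 * (1 / (n + 1 : ℝ)), by positivity, ?_⟩, ?_, fun n => le_rfl⟩
  · have : (0 : ℝ) < 1 / (n + 1 : ℝ) := by positivity
    linarith
  · simpa using tendsto_one_div_add_atTop_nhds_zero_nat.const_mul (2 : ℝ)

end Mollification

open scoped Convolution in
/-- Leibniz rule in `BV(]a,b[)`: if `v, w ∈ BV(]a,b[)` (with one–sided limits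
`vp, vm, wp, wm` and distributional derivatives encoded as differences of the
finite measures `Dvp - Dvm`, `Dwp - Dwm` via integration by parts), then
`vw ∈ BV(]a,b[)` and `D(vw) = v* Dw + w* Dv` in the sense of measures, where
`v* = (v(x⁺)+v(x⁻))/2` and `w* = (w(x⁺)+w(x⁻))/2` are the precise
representatives. -/
theorem stmt5 (a b : ℝ) (hab : a < b)
    (v w vp vm wp wm : ℝ → ℝ)
    (hv : BoundedVariationOn v (Set.Ioo a b))
    (hw : BoundedVariationOn w (Set.Ioo a b))
    (hvp : ∀ x ∈ Set.Ioo a b, Filter.Tendsto v (nhdsWithin x (Set.Ioi x)) (nhds (vp x)))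
    (hvm : ∀ x ∈ Set.Ioo a b, Filter.Tendsto v (nhdsWithin x (Set.Iio x)) (nhds (vm x)))
    (hwp : ∀ x ∈ Set.Ioo a b, Filter.Tendsto w (nhdsWithin x (Set.Ioi x)) (nhds (wp x)))
    (hwm : ∀ x ∈ Set.Ioo a b, Filter.Tendsto w (nhdsWithin x (Set.Iio x)) (nhds (wm x)))
    (Dvp Dvm Dwp Dwm : MeasureTheory.Measure ℝ)
    [IsFiniteMeasure Dvp] [IsFiniteMeasure Dvm]
    [IsFiniteMeasure Dwp] [IsFiniteMeasure Dwm]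
    -- Dv = Dvp - Dvm is the distributional derivative of v
    (hDv : ∀ φ : ℝ → ℝ, ContDiff ℝ 1 φ → HasCompactSupport φ →
      tsupport φ ⊆ Set.Ioo a b →
      ∫ x in Set.Ioo a b, v x * deriv φ x =
        -((∫ x, φ x ∂Dvp) - (∫ x, φ x ∂Dvm)))
    -- Dw = Dwp - Dwm is the distributional derivative of w
    (hDw : ∀ φ : ℝ → ℝ, ContDiff ℝ 1 φ → HasCompactSupport φ →
      tsupport φ ⊆ Set.Ioo a b →
      ∫ x in Set.Ioo a b, w x * deriv φ x =
        -((∫ x, φ x ∂Dwp) - (∫ x, φ x ∂Dwm))) :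
    BoundedVariationOn (fun x => v x * w x) (Set.Ioo a b) ∧
    ∀ φ : ℝ → ℝ, ContDiff ℝ 1 φ → HasCompactSupport φ →
      tsupport φ ⊆ Set.Ioo a b →
      ∫ x in Set.Ioo a b, v x * w x * deriv φ x =
        -(((∫ x, φ x * ((vp x + vm x) / 2) ∂Dwp)
            - (∫ x, φ x * ((vp x + vm x) / 2) ∂Dwm))
          + ((∫ x, φ x * ((wp x + wm x) / 2) ∂Dvp)
            - (∫ x, φ x * ((wp x + wm x) / 2) ∂Dvm))) := by
  refine ⟨hv.mul hw, fun φ hφ hφc hφs => ?_⟩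
  have hIoo : ∀ x ∈ Ioo a b, Ioo a b ∈ nhds x := fun x hx => isOpen_Ioo.mem_nhds hx
  obtain ⟨ρ, hρ, hρ2⟩ := ContDiffBump.exists_tendsto_rOut_zero
  set V := (Ioo a b).indicator v with hVdef
  set W := (Ioo a b).indicator w with hWdef
  obtain ⟨Cv, hCv⟩ : ∃ C, ∀ x, |V x| ≤ C := hv.exists_abs_indicator_le
  obtain ⟨Cw, hCw⟩ : ∃ C, ∀ x, |W x| ≤ C := hw.exists_abs_indicator_le
  have hVi : Integrable V := integrable_of_abs_le_of_support_subset
    (hv.aestronglyMeasurable_indicator measurableSet_Ioo _) hCv support_indicator_subset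
  have hWi : Integrable W := integrable_of_abs_le_of_support_subset
    (hw.aestronglyMeasurable_indicator measurableSet_Ioo _) hCw support_indicator_subset
  obtain ⟨Cφ, hCφ⟩ := hφc.exists_bound_of_continuous hφ.continuous
  have hφ' : Continuous (deriv φ) := hφ.continuous_deriv le_rfl
  obtain ⟨Cφ', hCφ'⟩ := hφc.deriv.exists_bound_of_continuous hφ'
  set F : ℝ → ℝ := fun x => φ x * W x with hFdef
  have hFi : Integrable F :=
    hWi.bdd_mul hφ.continuous.aestronglyMeasurable (Eventually.of_forall hCφ)
  have hFsupp : Function.support F ⊆ tsupport φ :=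
    (Function.support_mul_subset_left _ _).trans (subset_tsupport φ)
  have hCF : ∀ x, |F x| ≤ Cφ * Cw := fun x => by
    rw [hFdef, abs_mul]
    exact mul_le_mul (hCφ x) (hCw x) (abs_nonneg _) ((norm_nonneg _).trans (hCφ x))
  have hφW : Integrable fun x => deriv φ x * W x :=
    hWi.bdd_mul hφ'.aestronglyMeasurable (Eventually.of_forall hCφ')
  set Vn : ℕ → ℝ → ℝ := fun n => (ρ n).normed volume ⋆[ContinuousLinearMap.lsmul ℝ ℝ, volume] V with hVn
  set Fn : ℕ → ℝ → ℝ := fun n => (ρ n).normed volume ⋆[ContinuousLinearMap.lsmul ℝ ℝ, volume] F with hFn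
  have hVn1 : ∀ n, ContDiff ℝ 1 (Vn n) := fun n =>
    (ρ n).contDiff_convolution hVi.locallyIntegrable
  have limV : ∀ (μ : Measure ℝ) [IsFiniteMeasure μ],
      Tendsto (fun n => ∫ x, φ x * Vn n x ∂μ) atTop
        (nhds (∫ x, φ x * ((vp x + vm x) / 2) ∂μ)) := fun μ _ => by
    refine ContDiffBump.tendsto_integral_mul_convolution ρ hVi.locallyIntegrable hCv
      (hφ.continuous.integrable_of_hasCompactSupport hφc) (Eventually.of_forall fun x hx => ?_)
    have hxI := hφs (subset_tsupport φ hx)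
    exact ContDiffBump.tendsto_convolution_midpoint hρ hVi.locallyIntegrable
      (tendsto_indicator_nhdsWithin (hIoo x hxI) (hvp x hxI))
      (tendsto_indicator_nhdsWithin (hIoo x hxI) (hvm x hxI))
  have limF : ∀ (μ : Measure ℝ) [IsFiniteMeasure μ],
      Tendsto (fun n => ∫ x, Fn n x ∂μ) atTop
        (nhds (∫ x, φ x * ((wp x + wm x) / 2) ∂μ)) := fun μ _ => by
    have h := ContDiffBump.tendsto_integral_mul_convolution (μ := μ) ρ
      (L := fun x => φ x * ((wp x + wm x) / 2)) hFi.locallyIntegrable hCF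
      (integrable_const (1 : ℝ)) (Eventually.of_forall fun x _ => ?_)
    · simpa only [one_mul] using h
    by_cases hx : x ∈ tsupport φ
    · have hxI := hφs hx
      have hφx := fun s : Set ℝ => (hφ.continuous.tendsto x).mono_left (nhdsWithin_le_nhds (s := s))
      have h := ContDiffBump.tendsto_convolution_midpoint hρ hFi.locallyIntegrable
        ((hφx _).mul (tendsto_indicator_nhdsWithin (hIoo x hxI) (hwp x hxI)))
        ((hφx _).mul (tendsto_indicator_nhdsWithin (hIoo x hxI) (hwm x hxI)))
      convert h using 2
      ring
    · have hF0 : Tendsto F (nhds x) (nhds 0) := by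
        refine tendsto_const_nhds.congr' ?_
        filter_upwards [notMem_tsupport_iff_eventuallyEq.1 hx] with y hy
        simp [hFdef, hy]
      have h := ContDiffBump.tendsto_convolution_midpoint hρ hFi.locallyIntegrable
        (hF0.mono_left nhdsWithin_le_nhds) (hF0.mono_left nhdsWithin_le_nhds)
      simpa [image_eq_zero_of_notMem_tsupport hx] using h
  have limVW : Tendsto (fun n => ∫ x, deriv φ x * W x * Vn n x) atTop
      (nhds (∫ x, deriv φ x * W x * V x)) := by
    refine ContDiffBump.tendsto_integral_mul_convolution ρ hVi.locallyIntegrable hCv hφW ?_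
    filter_upwards [ContDiffBump.ae_convolution_tendsto_right_of_locallyIntegrable hρ
      (Eventually.of_forall hρ2) hVi.locallyIntegrable] with x hx _ using hx
  obtain ⟨δ, hδ, hδs⟩ :=
    hφc.isCompact.exists_cthickening_subset_open isOpen_Ioo hφs
  have hindicator : ∀ f g : ℝ → ℝ, ∫ x in Ioo a b, f x * g x = ∫ x, (Ioo a b).indicator f x * g x :=
    fun f g => by
      rw [← integral_indicator measurableSet_Ioo]
      simp only [indicator_mul_left]
  have key : ∀ᶠ n in atTop, (∫ x, deriv φ x * W x * Vn n x) +
      ((∫ x, Fn n x ∂Dvp) - ∫ x, Fn n x ∂Dvm) =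
      -((∫ x, φ x * Vn n x ∂Dwp) - ∫ x, φ x * Vn n x ∂Dwm) := by
    filter_upwards [hρ.eventually (gt_mem_nhds hδ)] with n hn
    have hφVs : tsupport (fun x => φ x * Vn n x) ⊆ tsupport φ :=
      closure_mono (Function.support_mul_subset_left _ _)
    rw [← hDw (fun x => φ x * Vn n x) (hφ.mul (hVn1 n)) hφc.mul_right (hφVs.trans hφs),
      hindicator, ← hWdef]
    have hFns : tsupport (Fn n) ⊆ Metric.cthickening δ (tsupport φ) :=
      ((ρ n).tsupport_convolution_subset hFsupp).trans (Metric.cthickening_mono hn.le _)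
    have hFD := hDv (Fn n) ((ρ n).contDiff_convolution hFi.locallyIntegrable)
      (hφc.isCompact.cthickening.of_isClosed_subset (isClosed_tsupport _) hFns) (hFns.trans hδs)
    rw [hindicator, ← hVdef] at hFD
    have hadj := (ρ n).integral_mul_deriv_convolution hFi hVi
    rw [hFD, neg_neg] at hadj
    rw [← hadj, ← integral_add]
    · refine integral_congr_ae (Eventually.of_forall fun x => ?_)
      have hd : deriv (fun x => φ x * Vn n x) x = deriv φ x * Vn n x + φ x * deriv (Vn n) x :=
        deriv_fun_mul (hφ.differentiable one_ne_zero x) ((hVn1 n).differentiable one_ne_zero x)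
      simp only [hd, hFdef]
      ring
    · exact hφW.mul_bdd (hVn1 n).continuous.aestronglyMeasurable
        (Eventually.of_forall ((ρ n).abs_convolution_le hCv))
    · have hdc : Continuous fun x => φ x * deriv (Vn n) x :=
        hφ.continuous.mul ((hVn1 n).continuous_deriv le_rfl)
      obtain ⟨C, hC⟩ := hφc.mul_right.exists_bound_of_continuous hdc
      refine (hWi.bdd_mul hdc.aestronglyMeasurable (Eventually.of_forall hC)).congr
        (Eventually.of_forall fun x => ?_)
      simp only [hFdef]
      ring
  have hlim := tendsto_nhds_unique_of_eventuallyEq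
    (limVW.add ((limF Dvp).sub (limF Dvm))) ((limV Dwp).sub (limV Dwm)).neg key
  have hVW : ∫ x in Ioo a b, v x * w x * deriv φ x = ∫ x, deriv φ x * W x * V x := by
    rw [hindicator]
    refine integral_congr_ae (Eventually.of_forall fun x => ?_)
    by_cases hx : x ∈ Ioo a b
    · simp only [hVdef, hWdef, indicator_of_mem hx]
      ring
    · simp [hVdef, indicator_of_notMem hx]
  rw [hVW]
  linarith
end

section
/- Let u ∈ BV(]a,b[) and let g : ]a,b[ → [0,∞[ be a Borel function. Then the coarea formula holds: ∫_{]a,b[} g(x) d|Du|(x) = ∫_{−∞}^{+∞} ( ∫_{ { x : u(x⁻) ∧ u(x⁺) ≤ t ≤ u(x⁻) ∨ u(x⁺) } } g(x) dH⁰(x) ) dt, where H⁰ is the counting measure. -/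
open Set Filter MeasureTheory ENNReal Topology

/-- The points of `I` at which the interval spanned by the one-sided limits contains `t`. -/
def crossing (I : Set ℝ) (um up : ℝ → ℝ) (t : ℝ) : Set ℝ :=
  {x ∈ I | min (um x) (up x) ≤ t ∧ t ≤ max (um x) (up x)}

/-- The levels crossed at some point of `B ∩ I`. -/
def crossedLevels (I : Set ℝ) (um up : ℝ → ℝ) (B : Set ℝ) : Set ℝ :=
  {t | (B ∩ crossing I um up t).Nonempty}

theorem isOpen_lt_min_limits {I : Set ℝ} (hI : IsOpen I) {u up um : ℝ → ℝ}
    (hup : ∀ x ∈ I, Tendsto u (𝓝[>] x) (𝓝 (up x)))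
    (hum : ∀ x ∈ I, Tendsto u (𝓝[<] x) (𝓝 (um x))) (t : ℝ) :
    IsOpen {x ∈ I | t < min (um x) (up x)} := by
  rw [isOpen_iff_mem_nhds]
  rintro x ⟨hx, htx⟩
  obtain ⟨s, hts, hsx⟩ := exists_between htx
  have limits_gt : ∀ y ∈ I, (∀ᶠ z in 𝓝 y, s < u z) → t < min (um y) (up y) := by
    intro y hy h
    exact lt_min
      (hts.trans_le (ge_of_tendsto (hum y hy) ((h.filter_mono nhdsWithin_le_nhds).mono fun _ => le_of_lt)))
      (hts.trans_le (ge_of_tendsto (hup y hy) ((h.filter_mono nhdsWithin_le_nhds).mono fun _ => le_of_lt)))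
  have side : ∀ J : Set ℝ, IsOpen J → (∀ᶠ z in 𝓝[J] x, s < u z) →
      ∀ᶠ y in 𝓝[J] x, y ∈ I ∧ t < min (um y) (up y) := by
    intro J hJ h
    filter_upwards [eventually_eventually_nhdsWithin.2 h, self_mem_nhdsWithin,
      nhdsWithin_le_nhds (hI.mem_nhds hx)] with y hy hyJ hyI
    rw [hJ.nhdsWithin_eq hyJ] at hy
    exact ⟨hyI, limits_gt y hyI hy⟩
  have hl := side _ isOpen_Iio ((hum x hx).eventually_const_lt (hsx.trans_le (min_le_left _ _)))
  have hr := side _ isOpen_Ioi ((hup x hx).eventually_const_lt (hsx.trans_le (min_le_right _ _)))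
  have hne : ∀ᶠ y in 𝓝[≠] x, y ∈ I ∧ t < min (um y) (up y) := by
    rw [← Iio_union_Ioi, nhdsWithin_union]
    exact eventually_sup.2 ⟨hl, hr⟩
  filter_upwards [eventually_nhdsWithin_iff.1 hne] with y hy
  by_cases hxy : y = x
  · exact hxy ▸ ⟨hx, htx⟩
  · exact hy hxy

theorem isOpen_max_limits_lt {I : Set ℝ} (hI : IsOpen I) {u up um : ℝ → ℝ}
    (hup : ∀ x ∈ I, Tendsto u (𝓝[>] x) (𝓝 (up x)))
    (hum : ∀ x ∈ I, Tendsto u (𝓝[<] x) (𝓝 (um x))) (t : ℝ) :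
    IsOpen {x ∈ I | max (um x) (up x) < t} := by
  have := isOpen_lt_min_limits hI (fun x hx => (hup x hx).neg) (fun x hx => (hum x hx).neg) (-t)
  simpa [min_neg_neg] using this

theorem measurableSet_crossing {I : Set ℝ} (hI : IsOpen I) {u up um : ℝ → ℝ}
    (hup : ∀ x ∈ I, Tendsto u (𝓝[>] x) (𝓝 (up x)))
    (hum : ∀ x ∈ I, Tendsto u (𝓝[<] x) (𝓝 (um x))) (t : ℝ) :
    MeasurableSet (crossing I um up t) := by
  have : crossing I um up t = (I \ {x ∈ I | t < min (um x) (up x)}) \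
      {x ∈ I | max (um x) (up x) < t} := by
    ext x
    simp only [crossing, mem_ofPred_eq, Set.mem_sdiff, not_and, not_lt]
    tauto
  rw [this]
  exact (hI.measurableSet.diff (isOpen_lt_min_limits hI hup hum t).measurableSet).diff
    (isOpen_max_limits_lt hI hup hum t).measurableSet

theorem exists_mem_crossing {I : Set ℝ} (hI : IsOpen I) {u up um : ℝ → ℝ}
    (hup : ∀ x ∈ I, Tendsto u (𝓝[>] x) (𝓝 (up x)))
    (hum : ∀ x ∈ I, Tendsto u (𝓝[<] x) (𝓝 (um x))) {J : Set ℝ} (hJ : IsPreconnected J)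
    (hJI : J ⊆ I) {x y t : ℝ} (hx : x ∈ J) (hy : y ∈ J) (hxt : min (um x) (up x) ≤ t)
    (hty : t ≤ max (um y) (up y)) : t ∈ crossedLevels I um up J := by
  by_contra h
  have key : ∀ z ∈ J, t < min (um z) (up z) ∨ max (um z) (up z) < t := by
    intro z hz
    by_contra! hz'
    exact h ⟨z, hz, hJI hz, hz'⟩
  obtain ⟨z, -, ⟨-, h1⟩, -, h2⟩ := hJ _ _ (isOpen_lt_min_limits hI hup hum t)
    (isOpen_max_limits_lt hI hup hum t)
    (fun z hz => (key z hz).imp (fun h => ⟨hJI hz, h⟩) (fun h => ⟨hJI hz, h⟩))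
    ⟨y, hy, hJI hy, (key y hy).resolve_right hty.not_gt⟩
    ⟨x, hx, hJI hx, (key x hx).resolve_left hxt.not_gt⟩
  exact (h1.trans_le min_le_max).not_gt h2

theorem crossedLevels_inter_self (I : Set ℝ) (um up : ℝ → ℝ) (B : Set ℝ) :
    crossedLevels I um up (B ∩ I) = crossedLevels I um up B := by
  ext t
  constructor
  · rintro ⟨x, hx, h⟩
    exact ⟨x, hx.1, h⟩
  · rintro ⟨x, hx, h⟩
    exact ⟨x, ⟨hx, h.1⟩, h⟩

theorem crossedLevels_mono (I : Set ℝ) (um up : ℝ → ℝ) {B C : Set ℝ} (h : B ⊆ C) :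
    crossedLevels I um up B ⊆ crossedLevels I um up C :=
  fun _ ht => ht.mono (inter_subset_inter_left _ h)

theorem ordConnected_crossedLevels {I : Set ℝ} (hI : IsOpen I) (hIc : I.OrdConnected)
    {u up um : ℝ → ℝ}
    (hup : ∀ x ∈ I, Tendsto u (𝓝[>] x) (𝓝 (up x)))
    (hum : ∀ x ∈ I, Tendsto u (𝓝[<] x) (𝓝 (um x))) {B : Set ℝ} (hB : B.OrdConnected) :
    (crossedLevels I um up B).OrdConnected := by
  rw [← crossedLevels_inter_self]
  refine ⟨?_⟩
  rintro s ⟨x, hx, -, hxs, -⟩ t ⟨y, hy, -, -, hyt⟩ r hr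
  exact exists_mem_crossing hI hup hum (hB.inter hIc).isPreconnected inter_subset_right hx hy
    (hxs.trans hr.1) (hr.2.trans hyt)

theorem volume_crossedLevels_Ioo_le {I : Set ℝ} {u up um : ℝ → ℝ}
    (hup : ∀ x ∈ I, Tendsto u (𝓝[>] x) (𝓝 (up x)))
    (hum : ∀ x ∈ I, Tendsto u (𝓝[<] x) (𝓝 (um x))) (c d : ℝ) :
    volume (crossedLevels I um up (Ioo c d)) ≤ eVariationOn u (Ioo c d) := by
  have hsub : crossedLevels I um up (Ioo c d) ⊆ convexHull ℝ (closure (u '' Ioo c d)) := by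
    rintro t ⟨x, hx, hxI, ht⟩
    have hmem : ∀ᶠ y in 𝓝 x, u y ∈ u '' Ioo c d := by
      filter_upwards [isOpen_Ioo.mem_nhds hx] with y hy using mem_image_of_mem u hy
    have hm : um x ∈ closure (u '' Ioo c d) :=
      mem_closure_of_tendsto (hum x hxI) (nhdsWithin_le_nhds hmem)
    have hp : up x ∈ closure (u '' Ioo c d) :=
      mem_closure_of_tendsto (hup x hxI) (nhdsWithin_le_nhds hmem)
    have : t ∈ segment ℝ (um x) (up x) := by
      rw [segment_eq_uIcc]
      exact ht
    exact segment_subset_convexHull hm hp this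
  calc volume (crossedLevels I um up (Ioo c d)) ≤ Metric.ediam (crossedLevels I um up (Ioo c d)) :=
        Real.volume_le_diam _
    _ ≤ Metric.ediam (convexHull ℝ (closure (u '' Ioo c d))) := Metric.ediam_mono hsub
    _ = Metric.ediam (u '' Ioo c d) := by rw [convexHull_ediam, Metric.ediam_closure]
    _ ≤ eVariationOn u (Ioo c d) := by
        refine Metric.ediam_le ?_
        rintro _ ⟨x, hx, rfl⟩ _ ⟨y, hy, rfl⟩
        exact eVariationOn.edist_le u hx hy

theorem volume_crossedLevels_singleton {I : Set ℝ} (um up : ℝ → ℝ) {x : ℝ} (hx : x ∈ I) :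
    volume (crossedLevels I um up {x}) = ENNReal.ofReal |um x - up x| := by
  have : crossedLevels I um up {x} = Icc (min (um x) (up x)) (max (um x) (up x)) := by
    ext t
    simp [crossedLevels, crossing, Set.Nonempty, hx]
  rw [this, Real.volume_Icc, max_sub_min_eq_abs']

theorem ofReal_sub_limits_le_volume_crossedLevels {I : Set ℝ} (hI : IsOpen I) {u up um : ℝ → ℝ}
    (hup : ∀ x ∈ I, Tendsto u (𝓝[>] x) (𝓝 (up x)))
    (hum : ∀ x ∈ I, Tendsto u (𝓝[<] x) (𝓝 (um x)))
    (hgood : ∀ x ∈ I, u x ∈ segment ℝ (um x) (up x)) {c d : ℝ} (hcd : c < d)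
    (hcdI : Icc c d ⊆ I) :
    ENNReal.ofReal |um d - up c| ≤ volume (crossedLevels I um up (Ioo c d)) := by
  have hc := hup c (hcdI (left_mem_Icc.2 hcd.le))
  have hd := hum d (hcdI (right_mem_Icc.2 hcd.le))
  have hsub : Ioo c d ⊆ I := Ioo_subset_Icc_self.trans hcdI
  have hIc : ∀ᶠ x in 𝓝[>] c, x ∈ Ioo c d := Ioo_mem_nhdsGT hcd
  have hId : ∀ᶠ x in 𝓝[<] d, x ∈ Ioo c d := Ioo_mem_nhdsLT hcd
  have hu : ∀ x ∈ Ioo c d, min (um x) (up x) ≤ u x ∧ u x ≤ max (um x) (up x) := by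
    intro x hx
    have := hgood x (hsub hx)
    rwa [segment_eq_uIcc] at this
  have : Ioo (min (um d) (up c)) (max (um d) (up c)) ⊆ crossedLevels I um up (Ioo c d) := by
    rintro t ⟨h1, h2⟩
    rcases le_total (um d) (up c) with h | h
    · rw [min_eq_left h] at h1
      rw [max_eq_right h] at h2
      obtain ⟨x, hx, hxI⟩ := ((hd.eventually_lt_const h1).and hId).exists
      obtain ⟨y, hy, hyI⟩ := ((hc.eventually_const_lt h2).and hIc).exists
      exact exists_mem_crossing hI hup hum isPreconnected_Ioo hsub hxI hyI
        ((hu x hxI).1.trans hx.le) (hy.le.trans (hu y hyI).2)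
    · rw [min_eq_right h] at h1
      rw [max_eq_left h] at h2
      obtain ⟨x, hx, hxI⟩ := ((hc.eventually_lt_const h1).and hIc).exists
      obtain ⟨y, hy, hyI⟩ := ((hd.eventually_const_lt h2).and hId).exists
      exact exists_mem_crossing hI hup hum isPreconnected_Ioo hsub hxI hyI
        ((hu x hxI).1.trans hx.le) (hy.le.trans (hu y hyI).2)
  calc _ = volume (Ioo (min (um d) (up c)) (max (um d) (up c))) := by
        rw [Real.volume_Ioo, max_sub_min_eq_abs']
    _ ≤ _ := measure_mono this

theorem count_ceil_image_le {B : Set ℝ} (hB : MeasurableSet B) (n : ℕ) :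
    Measure.count ((fun x : ℝ => ⌈((n : ℝ) + 1) * x⌉) '' B) ≤ Measure.count B := by
  rw [Measure.count_apply hB, Measure.count_apply (MeasurableSet.of_discrete)]
  exact_mod_cast encard_image_le _ _

theorem card_le_liminf_count_ceil_image {B : Set ℝ} {F : Finset ℝ} (hF : (F : Set ℝ) ⊆ B) :
    (F.card : ℝ≥0∞) ≤
      liminf (fun n : ℕ => Measure.count ((fun x : ℝ => ⌈((n : ℝ) + 1) * x⌉) '' B)) atTop := by
  have sep : ∀ x y : ℝ, x ≠ y → ∀ᶠ n : ℕ in atTop,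
      ⌈((n : ℝ) + 1) * x⌉ ≠ ⌈((n : ℝ) + 1) * y⌉ := by
    intro x y hxy
    have hpos : 0 < |x - y| := abs_pos.2 (sub_ne_zero.2 hxy)
    filter_upwards [(tendsto_natCast_atTop_atTop (R := ℝ)).eventually_gt_atTop (1 / |x - y|)]
      with n hn heq
    have h1 : |((n : ℝ) + 1) * x - ((n : ℝ) + 1) * y| < 1 := by
      have hx := Int.le_ceil (((n : ℝ) + 1) * x)
      have hx' := Int.ceil_lt_add_one (((n : ℝ) + 1) * x)
      have hy := Int.le_ceil (((n : ℝ) + 1) * y)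
      have hy' := Int.ceil_lt_add_one (((n : ℝ) + 1) * y)
      rw [heq] at hx hx'
      exact abs_sub_lt_iff.2 ⟨by linarith, by linarith⟩
    rw [← mul_sub, abs_mul, abs_of_pos (by positivity)] at h1
    rw [div_lt_iff₀ hpos] at hn
    nlinarith
  have inj : ∀ᶠ n : ℕ in atTop, ∀ x ∈ F, ∀ y ∈ F, x ≠ y →
      ⌈((n : ℝ) + 1) * x⌉ ≠ ⌈((n : ℝ) + 1) * y⌉ := by
    simp only [Filter.eventually_all_finset]
    intro x _ y _
    by_cases hxy : x = y
    · simp [hxy]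
    · simpa [hxy] using sep x y hxy
  refine le_liminf_of_le (by isBoundedDefault) ?_
  filter_upwards [inj] with n hn
  have hinj : InjOn (fun x : ℝ => ⌈((n : ℝ) + 1) * x⌉) F := by
    intro x hx y hy hxy
    by_contra hne
    exact hn x hx y hy hne hxy
  calc (F.card : ℝ≥0∞) = Measure.count (F.image fun x : ℝ => ⌈((n : ℝ) + 1) * x⌉ : Set ℤ) := by
        rw [Measure.count_apply_finset, Finset.card_image_of_injOn hinj]
    _ ≤ _ := by
        refine measure_mono ?_
        rw [Finset.coe_image]
        exact image_mono hF

theorem count_eq_liminf_count_ceil_image {B : Set ℝ} (hB : MeasurableSet B) :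
    Measure.count B =
      liminf (fun n : ℕ => Measure.count ((fun x : ℝ => ⌈((n : ℝ) + 1) * x⌉) '' B)) atTop := by
  refine le_antisymm ?_ ?_
  · rcases B.finite_or_infinite with hfin | hinf
    · rw [Measure.count_apply_finite B hfin]
      exact card_le_liminf_count_ceil_image (by simp)
    · rw [Measure.count_apply_infinite hinf, top_le_iff]
      refine ENNReal.eq_top_of_forall_nnreal_le fun r => ?_
      obtain ⟨n, hn⟩ := exists_nat_ge r
      obtain ⟨F, hF, rfl⟩ := hinf.exists_subset_card_eq n
      exact (by exact_mod_cast hn : (r : ℝ≥0∞) ≤ F.card).trans (card_le_liminf_count_ceil_image hF)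
  · exact liminf_le_of_frequently_le' (Frequently.of_forall fun n => count_ceil_image_le hB n)

theorem count_ceil_image_inter_crossing (I : Set ℝ) (um up : ℝ → ℝ) (B : Set ℝ) (n : ℕ) (t : ℝ) :
    Measure.count ((fun x : ℝ => ⌈((n : ℝ) + 1) * x⌉) '' (B ∩ crossing I um up t)) =
      ∑' k : ℤ, (crossedLevels I um up (B ∩ (fun x : ℝ => ⌈((n : ℝ) + 1) * x⌉) ⁻¹' {k})).indicator
        1 t := by
  rw [← lintegral_indicator_one MeasurableSet.of_discrete, lintegral_count]
  refine tsum_congr fun k => ?_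
  refine indicator_eq_indicator ?_ rfl
  constructor
  · rintro ⟨x, ⟨hxB, hxt⟩, rfl⟩
    exact ⟨x, ⟨hxB, rfl⟩, hxt⟩
  · rintro ⟨x, ⟨hxB, rfl⟩, hxt⟩
    exact ⟨x, ⟨hxB, hxt⟩, rfl⟩

theorem ordConnected_ceil_preimage (n : ℕ) (k : ℤ) :
    ((fun x : ℝ => ⌈((n : ℝ) + 1) * x⌉) ⁻¹' {k}).OrdConnected := by
  refine ordConnected_singleton.preimage_mono fun x y hxy => Int.ceil_mono ?_
  exact mul_le_mul_of_nonneg_left hxy (by positivity)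

theorem ceil_preimage_eq_Ioc (n : ℕ) (k : ℤ) :
    (fun x : ℝ => ⌈((n : ℝ) + 1) * x⌉) ⁻¹' {k} =
      Ioc (((k : ℝ) - 1) / ((n : ℝ) + 1)) ((k : ℝ) / ((n : ℝ) + 1)) := by
  have hn : (0 : ℝ) < (n : ℝ) + 1 := by positivity
  ext x
  rw [mem_preimage, mem_singleton_iff, Int.ceil_eq_iff, mem_Ioc, div_lt_iff₀ hn, le_div_iff₀ hn,
    mul_comm x]

theorem measurable_count_ceil_image {I : Set ℝ} (hI : IsOpen I) (hIc : I.OrdConnected)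
    {u up um : ℝ → ℝ}
    (hup : ∀ x ∈ I, Tendsto u (𝓝[>] x) (𝓝 (up x)))
    (hum : ∀ x ∈ I, Tendsto u (𝓝[<] x) (𝓝 (um x))) {B : Set ℝ} (hB : B.OrdConnected) (n : ℕ) :
    Measurable fun t => Measure.count
      ((fun x : ℝ => ⌈((n : ℝ) + 1) * x⌉) '' (B ∩ crossing I um up t)) := by
  simp only [count_ceil_image_inter_crossing]
  refine Measurable.tsum fun k => measurable_one.indicator ?_
  exact (ordConnected_crossedLevels hI hIc hup hum
    (hB.inter (ordConnected_ceil_preimage n k))).measurableSet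

theorem measurable_count_inter_crossing {I : Set ℝ} (hI : IsOpen I) (hIc : I.OrdConnected)
    {u up um : ℝ → ℝ}
    (hup : ∀ x ∈ I, Tendsto u (𝓝[>] x) (𝓝 (up x)))
    (hum : ∀ x ∈ I, Tendsto u (𝓝[<] x) (𝓝 (um x))) {B : Set ℝ} (hB : B.OrdConnected) :
    Measurable fun t => Measure.count (B ∩ crossing I um up t) := by
  have : (fun t => Measure.count (B ∩ crossing I um up t)) = fun t =>
      liminf (fun n : ℕ => Measure.count
        ((fun x : ℝ => ⌈((n : ℝ) + 1) * x⌉) '' (B ∩ crossing I um up t))) atTop := by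
    ext t
    exact count_eq_liminf_count_ceil_image
      (hB.measurableSet.inter (measurableSet_crossing hI hup hum t))
  rw [this]
  exact Measurable.liminf fun n => measurable_count_ceil_image hI hIc hup hum hB n

theorem lintegral_count_inter_crossing_le {I : Set ℝ} (hI : IsOpen I) (hIc : I.OrdConnected)
    {u up um : ℝ → ℝ}
    (hup : ∀ x ∈ I, Tendsto u (𝓝[>] x) (𝓝 (up x)))
    (hum : ∀ x ∈ I, Tendsto u (𝓝[<] x) (𝓝 (um x))) {B : Set ℝ} (hB : B.OrdConnected)
    (ν : Measure ℝ)
    (hν : ∀ c d, volume (crossedLevels I um up (B ∩ Ioc c d)) ≤ ν (B ∩ Ioc c d)) :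
    ∫⁻ t, Measure.count (B ∩ crossing I um up t) ≤ ν B := by
  have approx : ∀ n : ℕ, ∫⁻ t, Measure.count
      ((fun x : ℝ => ⌈((n : ℝ) + 1) * x⌉) '' (B ∩ crossing I um up t)) ≤ ν B := by
    intro n
    have hmeas : ∀ k : ℤ, MeasurableSet (crossedLevels I um up
        (B ∩ (fun x : ℝ => ⌈((n : ℝ) + 1) * x⌉) ⁻¹' {k})) := fun k =>
      (ordConnected_crossedLevels hI hIc hup hum
        (hB.inter (ordConnected_ceil_preimage n k))).measurableSet
    simp only [count_ceil_image_inter_crossing]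
    rw [lintegral_tsum fun k => (measurable_one.indicator (hmeas k)).aemeasurable]
    simp only [lintegral_indicator_one (hmeas _)]
    calc ∑' k : ℤ, volume (crossedLevels I um up
          (B ∩ (fun x : ℝ => ⌈((n : ℝ) + 1) * x⌉) ⁻¹' {k}))
        ≤ ∑' k : ℤ, ν (B ∩ (fun x : ℝ => ⌈((n : ℝ) + 1) * x⌉) ⁻¹' {k}) := by
          refine ENNReal.tsum_le_tsum fun k => ?_
          rw [ceil_preimage_eq_Ioc]
          exact hν _ _
      _ = ν (⋃ k : ℤ, B ∩ (fun x : ℝ => ⌈((n : ℝ) + 1) * x⌉) ⁻¹' {k}) := by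
          refine (measure_iUnion ?_ fun k =>
            (hB.inter (ordConnected_ceil_preimage n k)).measurableSet).symm
          intro j k hjk
          exact ((disjoint_singleton.2 hjk).preimage _).mono inter_subset_right inter_subset_right
      _ ≤ ν B := measure_mono (iUnion_subset fun k => inter_subset_left)
  calc ∫⁻ t, Measure.count (B ∩ crossing I um up t)
      = ∫⁻ t, liminf (fun n : ℕ => Measure.count
        ((fun x : ℝ => ⌈((n : ℝ) + 1) * x⌉) '' (B ∩ crossing I um up t))) atTop :=
        lintegral_congr fun t => count_eq_liminf_count_ceil_image
          (hB.measurableSet.inter (measurableSet_crossing hI hup hum t))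
    _ ≤ _ := lintegral_liminf_le fun n => measurable_count_ceil_image hI hIc hup hum hB n
    _ ≤ ν B := liminf_le_of_frequently_le' (Frequently.of_forall approx)

theorem le_measure_Ioc_of_forall_Ioo {ν : Measure ℝ} [IsFiniteMeasure ν] {K : ℝ≥0∞} {c d : ℝ}
    (h : ∀ e > d, K ≤ ν (Ioo c e)) : K ≤ ν (Ioc c d) := by
  have hset : (⋂ n : ℕ, Ioo c (d + 1 / ((n : ℝ) + 1))) = Ioc c d := by
    ext x
    simp only [mem_iInter, mem_Ioo, mem_Ioc, forall_and, forall_const]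
    refine and_congr_right fun _ => ⟨fun hx => ?_, fun hx n => ?_⟩
    · refine le_of_forall_pos_le_add fun ε hε => ?_
      obtain ⟨n, hn⟩ := exists_nat_one_div_lt hε
      linarith [hx n]
    · have : 0 < 1 / ((n : ℝ) + 1) := Nat.one_div_pos_of_nat
      linarith
  rw [← hset]
  have hanti : Antitone fun n : ℕ => Ioo c (d + 1 / ((n : ℝ) + 1)) := by
    intro m n hmn
    refine Ioo_subset_Ioo_right ?_
    gcongr
  refine ge_of_tendsto' (tendsto_measure_iInter_atTop
    (fun n => measurableSet_Ioo.nullMeasurableSet) hanti ⟨0, measure_ne_top _ _⟩) fun n => ?_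
  exact h _ (lt_add_of_pos_right d Nat.one_div_pos_of_nat)

theorem eVariationOn_Ioo_le_of_volume_crossedLevels_le {I : Set ℝ} (hI : IsOpen I)
    {u up um : ℝ → ℝ}
    (hup : ∀ x ∈ I, Tendsto u (𝓝[>] x) (𝓝 (up x)))
    (hum : ∀ x ∈ I, Tendsto u (𝓝[<] x) (𝓝 (um x)))
    (hgood : ∀ x ∈ I, ∃ θ ∈ Icc (0 : ℝ) 1, u x = θ * um x + (1 - θ) * up x)
    (μ : Measure ℝ) [IsFiniteMeasure μ]
    (hμ : ∀ B, MeasurableSet B → volume (crossedLevels I um up B) ≤ μ B) {c d : ℝ}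
    (hcd : Ioo c d ⊆ I) :
    eVariationOn u (Ioo c d) ≤ μ (Ioo c d) := by
  choose! θ hθ hu using hgood
  have hseg : ∀ x ∈ I, u x ∈ segment ℝ (um x) (up x) := by
    intro x hx
    rw [hu x hx]
    exact ⟨θ x, 1 - θ x, (hθ x hx).1, sub_nonneg.2 (hθ x hx).2, by ring, by simp⟩
  have hjump : ∀ x ∈ I, |um x - up x| ≤ μ.real {x} := by
    intro x hx
    rw [measureReal_def, ← ENNReal.ofReal_le_iff_le_toReal (measure_ne_top _ _),
      ← volume_crossedLevels_singleton um up hx]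
    exact hμ _ (measurableSet_singleton x)
  have hgap : ∀ x y, x < y → Icc x y ⊆ I → |um y - up x| ≤ μ.real (Ioo x y) := by
    intro x y hxy hI'
    rw [measureReal_def, ← ENNReal.ofReal_le_iff_le_toReal (measure_ne_top _ _)]
    exact (ofReal_sub_limits_le_volume_crossedLevels hI hup hum hseg hxy hI').trans
      (hμ _ measurableSet_Ioo)
  set F : ℝ → ℝ := fun z => μ.real (Ioo c z) + (1 - θ z) * μ.real {z} with hF
  have hIoc : ∀ z, c < z → μ.real (Ioc c z) = μ.real (Ioo c z) + μ.real {z} := by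
    intro z hz
    rw [← Ioo_union_right hz, measureReal_union (by simp) (measurableSet_singleton z)]
  have hF0 : ∀ z ∈ Ioo c d, 0 ≤ F z := by
    intro z hz
    have := (hθ z (hcd hz)).2
    exact add_nonneg measureReal_nonneg (mul_nonneg (sub_nonneg.2 this) measureReal_nonneg)
  have hF1 : ∀ z ∈ Ioo c d, F z ≤ μ.real (Ioo c d) := by
    intro z hz
    have h1 : μ.real (Ioc c z) ≤ μ.real (Ioo c d) :=
      measureReal_mono (Ioc_subset_Ioo_right hz.2)
    rw [hIoc z hz.1] at h1
    have h2 : 0 ≤ θ z * μ.real {z} := mul_nonneg (hθ z (hcd hz)).1 measureReal_nonneg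
    simp only [hF]
    linarith
  have hinc : ∀ x ∈ Ioo c d, ∀ y ∈ Ioo c d, x ≤ y → |u y - u x| ≤ F y - F x := by
    intro x hx y hy hxy
    rcases hxy.eq_or_lt with rfl | hlt
    · simp
    have hIoo : μ.real (Ioo c y) = μ.real (Ioo c x) + μ.real {x} + μ.real (Ioo x y) := by
      rw [← Ioc_union_Ioo_eq_Ioo hx.1.le hlt, measureReal_union _ measurableSet_Ioo, hIoc x hx.1]
      exact disjoint_left.2 fun z hz hz' => hz.2.not_gt hz'.1
    have hg := hgap x y hlt ((Icc_subset_Ioo hx.1 hy.2).trans hcd)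
    have hθx := hθ x (hcd hx)
    have hθy := hθ y (hcd hy)
    have hjx := mul_le_mul_of_nonneg_left (hjump x (hcd hx)) hθx.1
    have hjy := mul_le_mul_of_nonneg_left (hjump y (hcd hy)) (sub_nonneg.2 hθy.2)
    have hdecomp : u y - u x = (um y - up x) + (1 - θ y) * (up y - um y)
        + θ x * (up x - um x) := by
      rw [hu x (hcd hx), hu y (hcd hy)]
      ring
    have htri := abs_add_three (um y - up x) ((1 - θ y) * (up y - um y)) (θ x * (up x - um x))
    rw [abs_mul, abs_mul, abs_of_nonneg hθx.1, abs_of_nonneg (sub_nonneg.2 hθy.2),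
      abs_sub_comm (up y), abs_sub_comm (up x), ← hdecomp] at htri
    simp only [hF]
    rw [hIoo]
    linarith
  refine iSup_le ?_
  rintro ⟨n, p, hp, hpm⟩
  calc ∑ i ∈ Finset.range n, edist (u (p (i + 1))) (u (p i))
      ≤ ∑ i ∈ Finset.range n, ENNReal.ofReal (F (p (i + 1)) - F (p i)) := by
        refine Finset.sum_le_sum fun i _ => ?_
        rw [edist_dist, Real.dist_eq]
        exact ENNReal.ofReal_le_ofReal (hinc _ (hpm _) _ (hpm _) (hp i.le_succ))
    _ = ENNReal.ofReal (F (p n) - F (p 0)) := by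
        rw [← ENNReal.ofReal_sum_of_nonneg, Finset.sum_range_sub (fun i => F (p i))]
        exact fun i _ => (abs_nonneg _).trans (hinc _ (hpm _) _ (hpm _) (hp i.le_succ))
    _ ≤ ENNReal.ofReal (μ.real (Ioo c d)) :=
        ENNReal.ofReal_le_ofReal (by linarith [hF0 _ (hpm 0), hF1 _ (hpm n)])
    _ = μ (Ioo c d) := ofReal_measureReal

theorem coarea_of_measure_Ioo_eq_eVariationOn {I : Set ℝ} (hI : IsOpen I) (hIc : I.OrdConnected)
    {u up um : ℝ → ℝ}
    (hup : ∀ x ∈ I, Tendsto u (𝓝[>] x) (𝓝 (up x)))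
    (hum : ∀ x ∈ I, Tendsto u (𝓝[<] x) (𝓝 (um x)))
    (hgood : ∀ x ∈ I, ∃ θ ∈ Icc (0 : ℝ) 1, u x = θ * um x + (1 - θ) * up x)
    (ν : Measure ℝ) [IsFiniteMeasure ν]
    (hν : ∀ c d, ∃ c' d', Ioo c d ∩ I = Ioo c' d' ∧ ν (Ioo c d) = eVariationOn u (Ioo c' d'))
    {g : ℝ → ℝ≥0∞} (hg : Measurable g) :
    ∫⁻ x, g x ∂ν = ∫⁻ t, ∫⁻ x in crossing I um up t, g x ∂Measure.count := by
  have hIoc : ∀ c d, volume (crossedLevels I um up (Ioc c d)) ≤ ν (Ioc c d) := by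
    intro c d
    refine le_measure_Ioc_of_forall_Ioo fun e he => ?_
    obtain ⟨c', d', hI', hν'⟩ := hν c e
    refine (measure_mono (crossedLevels_mono I um up (Ioc_subset_Ioo_right he))).trans ?_
    rw [← crossedLevels_inter_self, hI', hν']
    exact volume_crossedLevels_Ioo_le hup hum c' d'
  have hmeasN : ∀ {B : Set ℝ}, B.OrdConnected →
      Measurable fun t => Measure.count (B ∩ crossing I um up t) :=
    fun hB => measurable_count_inter_crossing hI hIc hup hum hB
  have htotal : ∫⁻ t, Measure.count (univ ∩ crossing I um up t) ≤ ν univ :=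
    lintegral_count_inter_crossing_le hI hIc hup hum ordConnected_univ ν (by simpa using hIoc)
  have hfin : ∀ᵐ t, Measure.count (univ ∩ crossing I um up t) < ∞ :=
    ae_lt_top (hmeasN ordConnected_univ) (htotal.trans_lt (measure_lt_top _ _)).ne
  simp only [univ_inter] at hfin
  set G : Set ℝ := {t | Measure.count (crossing I um up t) < ∞} with hG
  have hGm : MeasurableSet G := by
    have := hmeasN ordConnected_univ
    simp only [univ_inter] at this
    exact measurableSet_lt this measurable_const
  classical
  let κ : ℝ → Measure ℝ := fun t => if t ∈ G then Measure.count.restrict (crossing I um up t) else 0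
  have hκ : ∀ᵐ t, κ t = Measure.count.restrict (crossing I um up t) := by
    filter_upwards [hfin] with t ht using if_pos ht
  have hκfin : ∀ t, IsFiniteMeasure (κ t) := by
    intro t
    by_cases ht : t ∈ G
    · simp only [κ, if_pos ht]
      exact ⟨by rwa [Measure.restrict_apply_univ]⟩
    · simp only [κ, if_neg ht]
      infer_instance
  have hκm : ∀ {B : Set ℝ}, B.OrdConnected → Measurable fun t => κ t B := by
    intro B hB
    have : (fun t => κ t B) = G.indicator fun t => Measure.count (B ∩ crossing I um up t) := by
      ext t
      by_cases ht : t ∈ G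
      · simp [κ, ht, Measure.restrict_apply hB.measurableSet]
      · simp [κ, ht]
    rw [this]
    exact (hmeasN hB).indicator hGm
  have hκmeas : Measurable κ := by
    refine Measurable.measure_of_isPiSystem (S := {S : Set ℝ | ∃ l u, l < u ∧ Ioc l u = S})
      ?_ (isPiSystem_Ioc id id) ?_ (hκm ordConnected_univ)
    · rw [BorelSpace.measurable_eq (α := ℝ), borel_eq_generateFrom_Ioc]
    · rintro _ ⟨l, r, -, rfl⟩
      exact hκm ordConnected_Ioc
  set μ : Measure ℝ := Measure.bind volume κ with hμdef
  have hμ : ∀ B, MeasurableSet B → μ B = ∫⁻ t, Measure.count (B ∩ crossing I um up t) := by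
    intro B hB
    rw [hμdef, Measure.bind_apply hB hκmeas.aemeasurable]
    refine lintegral_congr_ae ?_
    filter_upwards [hκ] with t ht
    rw [ht, Measure.restrict_apply hB]
  have hμfin : IsFiniteMeasure μ :=
    ⟨by rw [hμ _ MeasurableSet.univ]; exact htotal.trans_lt (measure_lt_top _ _)⟩
  have hlevels : ∀ B, MeasurableSet B → volume (crossedLevels I um up B) ≤ μ B := by
    intro B hB
    rw [hμ B hB]
    have hle : ∀ t ∈ crossedLevels I um up B, 1 ≤ Measure.count (B ∩ crossing I um up t) := by
      rintro t ⟨x, hx⟩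
      calc (1 : ℝ≥0∞) = Measure.count {x} := (Measure.count_singleton x).symm
        _ ≤ _ := measure_mono (singleton_subset_iff.2 hx)
    calc volume (crossedLevels I um up B)
        ≤ volume {t | 1 ≤ κ t B} := by
          refine measure_mono_ae ?_
          filter_upwards [hκ] with t ht htB
          change 1 ≤ κ t B
          rw [ht, Measure.restrict_apply hB]
          exact hle t htB
      _ ≤ ∫⁻ t, κ t B := by
          simpa using mul_meas_ge_le_lintegral₀
            ((Measure.measurable_coe hB).comp hκmeas).aemeasurable 1
      _ = ∫⁻ t, Measure.count (B ∩ crossing I um up t) := by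
          rw [← hμ B hB, hμdef, Measure.bind_apply hB hκmeas.aemeasurable]
  have heq : ν = μ := by
    refine Measure.ext_of_Ioc ν μ fun c d _ => le_antisymm ?_ ?_
    · refine le_measure_Ioc_of_forall_Ioo fun e he => ?_
      obtain ⟨c', d', hI', hν'⟩ := hν c e
      calc ν (Ioc c d) ≤ ν (Ioo c e) := measure_mono (Ioc_subset_Ioo_right he)
        _ = eVariationOn u (Ioo c' d') := hν'
        _ ≤ μ (Ioo c' d') := eVariationOn_Ioo_le_of_volume_crossedLevels_le hI hup hum hgood μ
            hlevels (hI' ▸ inter_subset_right)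
        _ ≤ μ (Ioo c e) := measure_mono (hI' ▸ inter_subset_left)
    · rw [hμ _ measurableSet_Ioc]
      refine lintegral_count_inter_crossing_le hI hIc hup hum ordConnected_Ioc ν fun c' d' => ?_
      rw [Ioc_inter_Ioc]
      exact hIoc _ _
  rw [heq, hμdef, Measure.lintegral_bind hκmeas.aemeasurable hg.aemeasurable]
  refine lintegral_congr_ae ?_
  filter_upwards [hκ] with t ht
  rw [ht]

/-- Coarea formula for a scalar BV function of one variable:
`∫ g d|Du| = ∫_ℝ (∫_{{x : u(x⁻)∧u(x⁺) ≤ t ≤ u(x⁻)∨u(x⁺)}} g dH⁰) dt`,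
where `|Du|` is the total variation measure, characterized on subintervals by
the pointwise variation of the good representative `u`, and `H⁰` is the
counting measure. -/
theorem stmt6 (a b : ℝ) (hab : a < b)
    (u up um : ℝ → ℝ)
    (hu : BoundedVariationOn u (Set.Ioo a b))
    (hup : ∀ x ∈ Set.Ioo a b, Filter.Tendsto u (nhdsWithin x (Set.Ioi x)) (nhds (up x)))
    (hum : ∀ x ∈ Set.Ioo a b, Filter.Tendsto u (nhdsWithin x (Set.Iio x)) (nhds (um x)))
    (hgood : ∀ x ∈ Set.Ioo a b, ∃ θ ∈ Set.Icc (0:ℝ) 1,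
      u x = θ * um x + (1 - θ) * up x)
    -- ν is the total variation measure |Du|
    (ν : MeasureTheory.Measure ℝ) [IsFiniteMeasure ν]
    (hν : ∀ x y : ℝ, a ≤ x → x ≤ y → y ≤ b →
      ν (Set.Ioo x y) = eVariationOn u (Set.Ioo x y))
    (g : ℝ → ℝ≥0∞) (hg : Measurable g) :
    ∫⁻ x in Set.Ioo a b, g x ∂ν =
      ∫⁻ t : ℝ,
        (∫⁻ x in {x ∈ Set.Ioo a b |
            min (um x) (up x) ≤ t ∧ t ≤ max (um x) (up x)},
          g x ∂MeasureTheory.Measure.count) ∂MeasureTheory.volume := by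
  have hrestrict : ∀ c d, ∃ c' d', Ioo c d ∩ Ioo a b = Ioo c' d' ∧
      ν.restrict (Ioo a b) (Ioo c d) = eVariationOn u (Ioo c' d') := by
    intro c d
    rw [Measure.restrict_apply measurableSet_Ioo, Ioo_inter_Ioo]
    rcases le_total (max c a) (min d b) with h | h
    · exact ⟨_, _, rfl, hν _ _ (le_max_right _ _) h (min_le_right _ _)⟩
    · refine ⟨_, _, rfl, ?_⟩
      rw [Ioo_eq_empty h.not_gt, measure_empty, eVariationOn.subsingleton u subsingleton_empty]
  exact coarea_of_measure_Ioo_eq_eVariationOn isOpen_Ioo ordConnected_Ioo hup hum hgood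
    (ν.restrict (Ioo a b)) hrestrict hg
end

section
/- Let B satisfy the chain rule hypotheses (and B(x,0) = 0, with all jump sets of B(·,t) and of (D_t B)(·,t) contained in a fixed countable set). For every piecewise constant function u(x) = Σ_{i=0}^N v^i χ*_{[a_i,a_{i+1}]}(x) with u ≥ 0, the following identity of the two forms of the x-derivative term holds: ∫_{−∞}^{+∞} dt ∫_{]a,b[} sgn(t) χ*_{Ω_{u,t}}(x) φ(x) d D_x(D_t B)(·,t) = Σ_{i=0}^N ∫_{]a,b[} φ(x) χ*_{[a_i,a_{i+1}]}(x) d(D_x B)(·, v^i), for every φ ∈ C_0¹(]a,b[). -/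
open Set Filter MeasureTheory

open scoped Classical

/-- The precise representative of the indicator of the half-line `[c, ∞)`. -/
noncomputable def halfStep (c x : ℝ) : ℝ :=
  ((Ici c).indicator (fun _ => (1 : ℝ)) x + (Ioi c).indicator (fun _ => (1 : ℝ)) x) / 2

lemma halfStep_of_lt {c x : ℝ} (h : c < x) : halfStep c x = 1 := by
  simp [halfStep, h, h.le]

lemma halfStep_of_gt {c x : ℝ} (h : x < c) : halfStep c x = 0 := by
  simp [halfStep, h, h.le]

lemma halfStep_self (c : ℝ) : halfStep c c = 1 / 2 := by
  simp [halfStep]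

lemma measurable_halfStep (c : ℝ) : Measurable (halfStep c) :=
  ((measurable_const.indicator measurableSet_Ici).add
    (measurable_const.indicator measurableSet_Ioi)).div_const 2

lemma abs_halfStep_le (c x : ℝ) : |halfStep c x| ≤ 1 := by
  rcases lt_trichotomy c x with h | rfl | h
  · simp [halfStep_of_lt h]
  · rw [halfStep_self]; norm_num
  · simp [halfStep_of_gt h]

lemma exists_contDiff_symmetric_step : ∃ η : ℝ → ℝ, ContDiff ℝ 1 η ∧ (∀ x ≤ -1, η x = 0) ∧
    (∀ x, 1 ≤ x → η x = 1) ∧ η 0 = 1 / 2 ∧ ∀ x, |η x| ≤ 1 := by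
  refine ⟨fun x => Real.smoothTransition ((x + 1) / 2), ?_, ?_, ?_, ?_, ?_⟩
  · exact Real.smoothTransition.contDiff.comp (by fun_prop)
  · intro x hx
    exact Real.smoothTransition.zero_of_nonpos (by linarith)
  · intro x hx
    exact Real.smoothTransition.one_of_one_le (by linarith)
  · have h : 0 < expNegInvGlue (1 / 2 : ℝ) := expNegInvGlue.pos_of_pos (by norm_num)
    simp only [Real.smoothTransition]
    norm_num
    norm_num at h
    field_simp
    norm_num
  · intro x
    rw [abs_of_nonneg (Real.smoothTransition.nonneg _)]
    exact Real.smoothTransition.le_one _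

lemma tendsto_integral_mul_deriv_step {η G : ℝ → ℝ} {c K L R : ℝ} (hη : ContDiff ℝ 1 η)
    (hη0 : ∀ x ≤ -1, η x = 0) (hη1 : ∀ x, 1 ≤ x → η x = 1) (hηc : η 0 = 1 / 2)
    (hG : Measurable G) (hK : ∀ x, |G x| ≤ K)
    (hL : Tendsto G (nhdsWithin c (Iio c)) (nhds L))
    (hR : Tendsto G (nhdsWithin c (Ioi c)) (nhds R)) :
    Tendsto (fun k : ℕ => ∫ x, G x * (((k : ℝ) + 1) * deriv η (((k : ℝ) + 1) * (x - c)))) atTop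
      (nhds ((L + R) / 2)) := by
  have hdc : Continuous (deriv η) := hη.continuous_deriv le_rfl
  have hsupp : HasCompactSupport (deriv η) := by
    refine HasCompactSupport.intro (isCompact_Icc (a := (-1 : ℝ)) (b := 1)) fun x hx => ?_
    rw [mem_Icc, not_and_or, not_le, not_le] at hx
    rcases hx with hx | hx
    · have : η =ᶠ[nhds x] fun _ => (0 : ℝ) := by
        filter_upwards [Iio_mem_nhds hx] with y hy using hη0 y (le_of_lt hy)
      rw [this.deriv_eq, deriv_const]
    · have : η =ᶠ[nhds x] fun _ => (1 : ℝ) := by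
        filter_upwards [Ioi_mem_nhds hx] with y hy using hη1 y (le_of_lt hy)
      rw [this.deriv_eq, deriv_const]
  have hint : Integrable (deriv η) := hdc.integrable_of_hasCompactSupport hsupp
  have hderiv : ∀ x, HasDerivAt η (deriv η x) x := fun x =>
    (hη.differentiable (by norm_num) x).hasDerivAt
  have hIoi : ∫ x in Ioi (0 : ℝ), deriv η x = 1 / 2 := by
    rw [integral_Ioi_of_hasDerivAt_of_tendsto' (m := 1) (fun x _ => hderiv x) hint.integrableOn, hηc]
    · norm_num
    · refine tendsto_const_nhds.congr' ?_
      filter_upwards [eventually_ge_atTop (1 : ℝ)] with x hx using (hη1 x hx).symm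
  have hIic : ∫ x in Iic (0 : ℝ), deriv η x = 1 / 2 := by
    rw [integral_Iic_of_hasDerivAt_of_tendsto' (m := 0) (fun x _ => hderiv x) hint.integrableOn, hηc]
    · norm_num
    · refine tendsto_const_nhds.congr' ?_
      filter_upwards [eventually_le_atBot (-1 : ℝ)] with x hx using (hη0 x hx).symm
  have hpos : ∀ k : ℕ, (0 : ℝ) < (k : ℝ) + 1 := fun k => by positivity
  have hsub : ∀ k : ℕ, ∫ x, G x * (((k : ℝ) + 1) * deriv η (((k : ℝ) + 1) * (x - c))) =
      ∫ y, G (c + y / ((k : ℝ) + 1)) * deriv η y := by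
    intro k
    have h1 := integral_sub_right_eq_self (μ := volume) (fun x : ℝ => ((k : ℝ) + 1) *
      (G (c + (((k : ℝ) + 1) * x) / ((k : ℝ) + 1)) * deriv η (((k : ℝ) + 1) * x))) c
    have h2 := Measure.integral_comp_mul_left
      (fun y => G (c + y / ((k : ℝ) + 1)) * deriv η y) ((k : ℝ) + 1)
    rw [integral_const_mul _ (fun x : ℝ => G (c + (((k : ℝ) + 1) * x) / ((k : ℝ) + 1)) *
      deriv η (((k : ℝ) + 1) * x)), h2, abs_of_pos (inv_pos.2 (hpos k)), smul_eq_mul,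
      mul_inv_cancel_left₀ (hpos k).ne'] at h1
    rw [← h1]
    refine integral_congr_ae (Eventually.of_forall fun x => ?_)
    have : c + (((k : ℝ) + 1) * (x - c)) / ((k : ℝ) + 1) = x := by
      have := (hpos k).ne'
      field_simp
      ring
    simp only [this]
    ring
  simp only [hsub]
  have hto : ∀ y : ℝ, Tendsto (fun k : ℕ => c + y / ((k : ℝ) + 1)) atTop (nhds c) := fun y => by
    simpa using (tendsto_const_div_atTop_nhds_zero_nat y).comp (tendsto_add_atTop_nat 1)
      |>.const_add c
  have hval : ∫ y, (if 0 < y then R else L) * deriv η y = (L + R) / 2 := by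
    have hm : MeasurableSet (Ioi (0 : ℝ)) := measurableSet_Ioi
    have hi : Integrable fun y : ℝ => (if 0 < y then R else L) * deriv η y := by
      refine hint.bdd_mul (c := |L| + |R|) ?_ (Eventually.of_forall fun y => ?_)
      · exact (Measurable.ite hm measurable_const measurable_const).aestronglyMeasurable
      · split_ifs <;> simp [Real.norm_eq_abs]
    rw [← integral_add_compl hm hi, compl_Ioi,
      setIntegral_congr_fun (g := fun y => R * deriv η y) hm
        (fun y hy => by simp only [if_pos (mem_Ioi.1 hy)]),
      setIntegral_congr_fun (g := fun y => L * deriv η y) measurableSet_Iic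
        (fun y hy => by simp only [if_neg (not_lt.2 (mem_Iic.1 hy))]),
      integral_const_mul, integral_const_mul, hIoi, hIic]
    ring
  rw [← hval]
  refine tendsto_integral_of_dominated_convergence (fun y => K * |deriv η y|) ?_
    (hint.abs.const_mul K) ?_ ?_
  · intro k
    exact ((hG.comp (by fun_prop)).mul hdc.measurable).aestronglyMeasurable
  · intro k
    refine Eventually.of_forall fun y => ?_
    rw [Real.norm_eq_abs, abs_mul]
    exact mul_le_mul_of_nonneg_right (hK _) (abs_nonneg _)
  · have h0 : ∀ᵐ y : ℝ, y ≠ 0 := by simp [ae_iff, measure_singleton]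
    filter_upwards [h0] with y hy
    refine Tendsto.mul_const _ ?_
    rcases lt_or_gt_of_ne hy with hy | hy
    · rw [if_neg (not_lt.2 hy.le)]
      refine hL.comp (tendsto_nhdsWithin_iff.2 ⟨hto y, Eventually.of_forall fun k => ?_⟩)
      have := div_neg_of_neg_of_pos hy (hpos k)
      simp only [mem_Iio]; linarith
    · rw [if_pos hy]
      refine hR.comp (tendsto_nhdsWithin_iff.2 ⟨hto y, Eventually.of_forall fun k => ?_⟩)
      have := div_pos hy (hpos k)
      simp only [mem_Ioi]; linarith

/-- Integration by parts against a test function truncated by the symmetric step at `c`. -/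
lemma integral_mul_halfStep_sub {g φ : ℝ → ℝ} {U : Set ℝ} {μ ν : Measure ℝ}
    [IsFiniteMeasure μ] [IsFiniteMeasure ν] {c K L R : ℝ}
    (hg : Measurable g) (hK : ∀ x, |g x| ≤ K)
    (hφ : ContDiff ℝ 1 φ) (hφc : HasCompactSupport φ) (hφU : tsupport φ ⊆ U)
    (hμν : ∀ ψ : ℝ → ℝ, ContDiff ℝ 1 ψ → HasCompactSupport ψ → tsupport ψ ⊆ U →
      ∫ x, deriv ψ x * g x = -((∫ x, ψ x ∂μ) - (∫ x, ψ x ∂ν)))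
    (hL : Tendsto (fun x => φ x * g x) (nhdsWithin c (Iio c)) (nhds L))
    (hR : Tendsto (fun x => φ x * g x) (nhdsWithin c (Ioi c)) (nhds R)) :
    (∫ x, φ x * halfStep c x ∂μ) - (∫ x, φ x * halfStep c x ∂ν) =
      -(∫ x, deriv φ x * halfStep c x * g x) - (L + R) / 2 := by
  obtain ⟨η, hη, hη0, hη1, hηc, hηb⟩ := exists_contDiff_symmetric_step
  obtain ⟨M, hM⟩ := hφc.exists_bound_of_continuous hφ.continuous
  have hM0 : 0 ≤ M := (norm_nonneg _).trans (hM 0)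
  have hφd : Continuous (deriv φ) := hφ.continuous_deriv le_rfl
  have hφdi : Integrable (deriv φ) := hφd.integrable_of_hasCompactSupport hφc.deriv
  have hηd : Continuous (deriv η) := hη.continuous_deriv le_rfl
  set s : ℕ → ℝ → ℝ := fun k x => η (((k : ℝ) + 1) * (x - c)) with hs
  have hsC : ∀ k, ContDiff ℝ 1 (s k) := fun k => hη.comp (by fun_prop)
  have hsd : ∀ k x, HasDerivAt (s k) (((k : ℝ) + 1) * deriv η (((k : ℝ) + 1) * (x - c))) x := by
    intro k x
    have h1 : HasDerivAt η (deriv η (((k : ℝ) + 1) * (x - c))) (((k : ℝ) + 1) * (x - c)) :=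
      (hη.differentiable (by norm_num) _).hasDerivAt
    have h2 : HasDerivAt (fun x : ℝ => ((k : ℝ) + 1) * (x - c)) ((k : ℝ) + 1) x := by
      simpa using ((hasDerivAt_id x).sub_const c).const_mul ((k : ℝ) + 1)
    simpa [hs, mul_comm, Function.comp_def] using h1.comp x h2
  have hslim : ∀ x, Tendsto (fun k => s k x) atTop (nhds (halfStep c x)) := by
    intro x
    have hat : Tendsto (fun k : ℕ => (k : ℝ) + 1) atTop atTop :=
      tendsto_atTop_add_const_right _ _ tendsto_natCast_atTop_atTop
    rcases lt_trichotomy c x with h | rfl | h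
    · rw [halfStep_of_lt h]
      refine tendsto_const_nhds.congr' ?_
      filter_upwards [(hat.atTop_mul_const (sub_pos.2 h)).eventually_ge_atTop 1] with k hk
        using (hη1 _ hk).symm
    · simp [hs, halfStep_self, hηc]
    · rw [halfStep_of_gt h]
      refine tendsto_const_nhds.congr' ?_
      filter_upwards [(hat.atTop_mul_const_of_neg (sub_neg.2 h)).eventually_le_atBot (-1)] with k hk
        using (hη0 _ hk).symm
  have hmeas : ∀ (m : Measure ℝ) [IsFiniteMeasure m],
      Tendsto (fun k => ∫ x, φ x * s k x ∂m) atTop (nhds (∫ x, φ x * halfStep c x ∂m)) := by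
    intro m _
    refine tendsto_integral_of_dominated_convergence (fun _ => M) ?_ (integrable_const M) ?_ ?_
    · exact fun k => (hφ.continuous.mul (hsC k).continuous).aestronglyMeasurable
    · refine fun k => Eventually.of_forall fun x => ?_
      rw [norm_mul]
      exact (mul_le_mul (hM x) (hηb _) (abs_nonneg _) hM0).trans_eq (mul_one M)
    · exact Eventually.of_forall fun x => (hslim x).const_mul _
  have hA : Tendsto (fun k => ∫ x, deriv φ x * s k x * g x) atTop
      (nhds (∫ x, deriv φ x * halfStep c x * g x)) := by
    refine tendsto_integral_of_dominated_convergence (fun x => |deriv φ x| * K) ?_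
      (hφdi.abs.mul_const K) ?_ ?_
    · exact fun k => (((hφd.mul (hsC k).continuous).measurable).mul hg).aestronglyMeasurable
    · refine fun k => Eventually.of_forall fun x => ?_
      rw [norm_mul, norm_mul]
      refine mul_le_mul ?_ (hK x) (norm_nonneg _) (abs_nonneg _)
      exact (mul_le_mul_of_nonneg_left (hηb _) (norm_nonneg _)).trans_eq (mul_one _)
    · exact Eventually.of_forall fun x => ((hslim x).const_mul _).mul_const _
  have hB := tendsto_integral_mul_deriv_step (G := fun x => φ x * g x) (K := M * K) hη hη0 hη1 hηc
    (hφ.continuous.measurable.mul hg)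
    (fun x => by
      rw [abs_mul]
      exact mul_le_mul (hM x) (hK x) (abs_nonneg _) hM0) hL hR
  have hk : ∀ k : ℕ, (∫ x, φ x * s k x ∂μ) - (∫ x, φ x * s k x ∂ν) =
      -((∫ x, deriv φ x * s k x * g x) +
        ∫ x, φ x * g x * (((k : ℝ) + 1) * deriv η (((k : ℝ) + 1) * (x - c)))) := by
    intro k
    have h := hμν (fun x => φ x * s k x) (hφ.mul (hsC k)) hφc.mul_right
      ((tsupport_mul_subset_left (f := φ) (g := s k)).trans hφU)
    have hi1 : Integrable fun x => deriv φ x * s k x * g x := by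
      refine ((hφd.mul (hsC k).continuous).integrable_of_hasCompactSupport
        hφc.deriv.mul_right).mul_bdd (c := K) hg.aestronglyMeasurable
        (Eventually.of_forall fun x => hK x)
    have hi2 : Integrable fun x =>
        φ x * g x * (((k : ℝ) + 1) * deriv η (((k : ℝ) + 1) * (x - c))) := by
      have hc : Continuous fun x => φ x * (((k : ℝ) + 1) * deriv η (((k : ℝ) + 1) * (x - c))) :=
        hφ.continuous.mul (continuous_const.mul (hηd.comp (by fun_prop)))
      refine ((hc.integrable_of_hasCompactSupport hφc.mul_right).mul_bdd (c := K)
        hg.aestronglyMeasurable (Eventually.of_forall fun x => hK x)).congr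
        (Eventually.of_forall fun x => ?_)
      simp only
      ring
    rw [← integral_add hi1 hi2, eq_comm, neg_eq_iff_eq_neg, ← h]
    refine integral_congr_ae (Eventually.of_forall fun x => ?_)
    have hd : HasDerivAt (fun x => φ x * s k x) _ x :=
      ((hφ.differentiable (by norm_num) x).hasDerivAt).mul (hsd k x)
    simp only [hd.deriv]
    ring
  have h1 := (hmeas μ).sub (hmeas ν)
  simp only [hk] at h1
  rw [tendsto_nhds_unique h1 (hA.add hB).neg]
  ring

/-- The signed integral of `φ` against the precise representative of the indicator of `[c, ∞)`. -/
noncomputable def halfStepPairing (φ : ℝ → ℝ) (μ ν : Measure ℝ) (c : ℝ) : ℝ :=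
  (∫ x, φ x * halfStep c x ∂μ) - (∫ x, φ x * halfStep c x ∂ν)

lemma measurable_uncurry_of_hasDerivAt {β d : ℝ → ℝ → ℝ} (hβ : ∀ t, Measurable (β t))
    (hd : ∀ t x, HasDerivAt (fun s => β s x) (d t x) t) : Measurable (Function.uncurry d) := by
  have hm : Measurable (Function.uncurry β) :=
    measurable_uncurry_of_continuous_of_measurable
      (fun x => continuous_iff_continuousAt.2 fun t => (hd t x).continuousAt) hβ
  have hlim : Tendsto (fun k : ℕ => (1 : ℝ) / ((k : ℝ) + 1)) atTop (nhdsWithin 0 {0}ᶜ) :=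
    tendsto_nhdsWithin_iff.2 ⟨tendsto_one_div_add_atTop_nhds_zero_nat,
      Eventually.of_forall fun k => by
        have : (0 : ℝ) < 1 / ((k : ℝ) + 1) := by positivity
        simpa using this.ne'⟩
  refine measurable_of_tendsto_metrizable (f := fun (k : ℕ) (z : ℝ × ℝ) =>
    ((1 : ℝ) / ((k : ℝ) + 1))⁻¹ * (β (z.1 + 1 / ((k : ℝ) + 1)) z.2 - β z.1 z.2)) ?_ ?_
  · intro k
    refine measurable_const.mul ((hm.comp (g := Function.uncurry β)
      (f := fun z : ℝ × ℝ => (z.1 + 1 / ((k : ℝ) + 1), z.2)) (by fun_prop)).sub hm)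
  · rw [tendsto_pi_nhds]
    rintro ⟨t, x⟩
    exact (hasDerivAt_iff_tendsto_slope_zero.1 (hd t x)).comp hlim

section TimeIntegral

variable {β d : ℝ → ℝ → ℝ} {v C : ℝ}

lemma intervalIntegral_deriv_eq (hβ : ∀ t, Measurable (β t))
    (hd : ∀ t x, HasDerivAt (fun s => β s x) (d t x) t) (hβ0 : ∀ x, β 0 x = 0)
    (hv : 0 ≤ v) (hC : ∀ t x, |t| ≤ v → |d t x| ≤ C) (x : ℝ) :
    ∫ t in (0 : ℝ)..v, d t x = β v x := by
  have hm := measurable_uncurry_of_hasDerivAt hβ hd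
  rw [intervalIntegral.integral_eq_sub_of_hasDerivAt (f := fun t => β t x) (fun t _ => hd t x),
    hβ0, sub_zero]
  rw [intervalIntegrable_iff, uIoc_of_le hv]
  refine Integrable.mono' (g := fun _ => C) (integrable_const C)
    (hm.comp (measurable_id.prodMk measurable_const)).aestronglyMeasurable ?_
  filter_upwards [ae_restrict_mem measurableSet_Ioc] with t ht
  exact hC t x (by rw [abs_of_pos ht.1]; exact ht.2)

lemma abs_le_of_deriv_bound (hβ : ∀ t, Measurable (β t))
    (hd : ∀ t x, HasDerivAt (fun s => β s x) (d t x) t) (hβ0 : ∀ x, β 0 x = 0)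
    (hv : 0 ≤ v) (hC : ∀ t x, |t| ≤ v → |d t x| ≤ C) (x : ℝ) : |β v x| ≤ C * v := by
  rw [← intervalIntegral_deriv_eq hβ hd hβ0 hv hC x]
  have := intervalIntegral.norm_integral_le_of_norm_le_const (a := 0) (b := v) (C := C)
    (f := fun t => d t x) (fun t ht => by
      rw [uIoc_of_le hv] at ht
      exact hC t x (by rw [abs_of_pos ht.1]; exact ht.2))
  simpa [abs_of_nonneg hv] using this

/-- Limits in `x` commute with integration in `t`. -/
lemma intervalIntegral_limit_eq (hβ : ∀ t, Measurable (β t))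
    (hd : ∀ t x, HasDerivAt (fun s => β s x) (d t x) t) (hβ0 : ∀ x, β 0 x = 0)
    (hv : 0 ≤ v) (hC : ∀ t x, |t| ≤ v → |d t x| ≤ C) {φ : ℝ → ℝ} {M : ℝ} (hM : ∀ x, |φ x| ≤ M)
    {l : Filter ℝ} [l.NeBot] [l.IsCountablyGenerated] {P : ℝ → ℝ} {p : ℝ}
    (hP : ∀ t, Tendsto (fun x => φ x * d t x) l (nhds (P t)))
    (hp : Tendsto (fun x => φ x * β v x) l (nhds p)) :
    IntervalIntegrable P volume 0 v ∧ ∫ t in (0 : ℝ)..v, P t = p := by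
  have hm := measurable_uncurry_of_hasDerivAt hβ hd
  have hM0 : 0 ≤ M := (abs_nonneg _).trans (hM 0)
  have hmx : ∀ x, Measurable fun t => φ x * d t x := fun x =>
    measurable_const.mul (hm.comp (measurable_id.prodMk measurable_const))
  have hbd : ∀ x, ∀ t ∈ Ioc 0 v, ‖φ x * d t x‖ ≤ M * C := fun x t ht => by
    rw [norm_mul]
    exact mul_le_mul (hM x) (hC t x (by rw [abs_of_pos ht.1]; exact ht.2)) (norm_nonneg _) hM0
  constructor
  · rw [intervalIntegrable_iff, uIoc_of_le hv]
    refine Integrable.mono' (g := fun _ => M * C) (integrable_const _)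
      (aestronglyMeasurable_of_tendsto_ae l (fun x => (hmx x).aestronglyMeasurable)
        (Eventually.of_forall hP)) ?_
    filter_upwards [ae_restrict_mem measurableSet_Ioc] with t ht
    exact le_of_tendsto (hP t).norm (Eventually.of_forall fun x => hbd x t ht)
  · have h := intervalIntegral.tendsto_integral_filter_of_dominated_convergence (μ := volume)
      (a := 0) (b := v) (l := l) (F := fun x t => φ x * d t x) (f := P) (fun _ => M * C)
      (Eventually.of_forall fun x => (hmx x).aestronglyMeasurable)
      (Eventually.of_forall fun x => Eventually.of_forall fun t ht =>
        hbd x t (by rwa [uIoc_of_le hv] at ht))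
      intervalIntegrable_const (Eventually.of_forall fun t _ => hP t)
    simp only [intervalIntegral.integral_const_mul,
      intervalIntegral_deriv_eq hβ hd hβ0 hv hC] at h
    exact tendsto_nhds_unique h hp

lemma intervalIntegral_integral_mul_eq (hβ : ∀ t, Measurable (β t))
    (hd : ∀ t x, HasDerivAt (fun s => β s x) (d t x) t) (hβ0 : ∀ x, β 0 x = 0)
    (hv : 0 ≤ v) (hC : ∀ t x, |t| ≤ v → |d t x| ≤ C) {w : ℝ → ℝ} (hw : Integrable w) :
    IntervalIntegrable (fun t => ∫ x, w x * d t x) volume 0 v ∧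
      ∫ t in (0 : ℝ)..v, ∫ x, w x * d t x = ∫ x, w x * β v x := by
  have hm := measurable_uncurry_of_hasDerivAt hβ hd
  have hi : Integrable (Function.uncurry fun t x => w x * d t x)
      ((volume.restrict (uIoc 0 v)).prod volume) := by
    have h1 : Integrable (fun z : ℝ × ℝ => C * |w z.2|)
        ((volume.restrict (uIoc 0 v)).prod volume) :=
      Integrable.mul_prod (f := fun _ => C) (g := fun x => |w x|)
        (by rw [uIoc_of_le hv]; exact integrable_const C) hw.abs
    refine h1.mono' (hw.aestronglyMeasurable.comp_snd.mul hm.aestronglyMeasurable) ?_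
    have h2 : ∀ᵐ z ∂((volume.restrict (uIoc 0 v)).prod (volume : Measure ℝ)),
        z.1 ∈ uIoc 0 v :=
      Measure.quasiMeasurePreserving_fst.ae (ae_restrict_mem measurableSet_uIoc)
    filter_upwards [h2] with z hz
    rw [uIoc_of_le hv] at hz
    rw [Function.uncurry_def, norm_mul, mul_comm]
    exact mul_le_mul_of_nonneg_right (hC _ _ (by rw [abs_of_pos hz.1]; exact hz.2)) (abs_nonneg _)
  refine ⟨intervalIntegrable_iff.2 hi.integral_prod_left, ?_⟩
  rw [intervalIntegral_integral_swap hi]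
  simp only [intervalIntegral.integral_const_mul, intervalIntegral_deriv_eq hβ hd hβ0 hv hC]

/-- Integrating in time the truncated pairing with `∂ₓ d(t, ·)` gives the truncated pairing
with `∂ₓ β(v, ·)`. -/
lemma intervalIntegral_halfStepPairing (hβ : ∀ t, Measurable (β t))
    (hd : ∀ t x, HasDerivAt (fun s => β s x) (d t x) t) (hβ0 : ∀ x, β 0 x = 0)
    (hbd : ∀ R, ∃ C, ∀ t x, |t| ≤ R → |d t x| ≤ C) (hv : 0 ≤ v)
    {φ : ℝ → ℝ} {U : Set ℝ} (hφ : ContDiff ℝ 1 φ) (hφc : HasCompactSupport φ)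
    (hφU : tsupport φ ⊆ U) {c : ℝ} {L R : ℝ → ℝ} {l r : ℝ}
    (hL : ∀ t, Tendsto (fun x => φ x * d t x) (nhdsWithin c (Iio c)) (nhds (L t)))
    (hR : ∀ t, Tendsto (fun x => φ x * d t x) (nhdsWithin c (Ioi c)) (nhds (R t)))
    (hl : Tendsto (fun x => φ x * β v x) (nhdsWithin c (Iio c)) (nhds l))
    (hr : Tendsto (fun x => φ x * β v x) (nhdsWithin c (Ioi c)) (nhds r))
    {Mp Mm : ℝ → Measure ℝ} {Np Nm : Measure ℝ}
    (hMp : ∀ t, IsFiniteMeasure (Mp t)) (hMm : ∀ t, IsFiniteMeasure (Mm t))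
    [IsFiniteMeasure Np] [IsFiniteMeasure Nm]
    (hM : ∀ t, ∀ ψ : ℝ → ℝ, ContDiff ℝ 1 ψ → HasCompactSupport ψ → tsupport ψ ⊆ U →
      ∫ x, deriv ψ x * d t x = -((∫ x, ψ x ∂(Mp t)) - (∫ x, ψ x ∂(Mm t))))
    (hN : ∀ ψ : ℝ → ℝ, ContDiff ℝ 1 ψ → HasCompactSupport ψ → tsupport ψ ⊆ U →
      ∫ x, deriv ψ x * β v x = -((∫ x, ψ x ∂Np) - (∫ x, ψ x ∂Nm))) :
    IntervalIntegrable (fun t => halfStepPairing φ (Mp t) (Mm t) c) volume 0 v ∧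
      ∫ t in (0 : ℝ)..v, halfStepPairing φ (Mp t) (Mm t) c = halfStepPairing φ Np Nm c := by
  obtain ⟨C, hC⟩ := hbd v
  obtain ⟨M, hMφ⟩ := hφc.exists_bound_of_continuous hφ.continuous
  have hm := measurable_uncurry_of_hasDerivAt hβ hd
  have hw : Integrable fun x => deriv φ x * halfStep c x :=
    ((hφ.continuous_deriv le_rfl).integrable_of_hasCompactSupport hφc.deriv).mul_bdd (c := 1)
      (measurable_halfStep c).aestronglyMeasurable
      (Eventually.of_forall fun x => abs_halfStep_le c x)
  have hF : (fun t => halfStepPairing φ (Mp t) (Mm t) c) = fun t =>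
      -(∫ x, deriv φ x * halfStep c x * d t x) - (L t + R t) / 2 := by
    funext t
    obtain ⟨K, hK⟩ := hbd |t|
    have := hMp t
    have := hMm t
    exact integral_mul_halfStep_sub (hm.comp (measurable_const.prodMk measurable_id))
      (fun x => hK t x le_rfl) hφ hφc hφU (hM t) (hL t) (hR t)
  have hFB : halfStepPairing φ Np Nm c =
      -(∫ x, deriv φ x * halfStep c x * β v x) - (l + r) / 2 :=
    integral_mul_halfStep_sub (hβ v) (abs_le_of_deriv_bound hβ hd hβ0 hv hC) hφ hφc hφU hN hl hr
  obtain ⟨hLi, hLe⟩ := intervalIntegral_limit_eq hβ hd hβ0 hv hC hMφ hL hl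
  obtain ⟨hRi, hRe⟩ := intervalIntegral_limit_eq hβ hd hβ0 hv hC hMφ hR hr
  obtain ⟨hIi, hIe⟩ := intervalIntegral_integral_mul_eq hβ hd hβ0 hv hC hw
  have hLR := (hLi.add hRi).div_const 2
  rw [hF, hFB]
  refine ⟨hIi.neg.sub hLR, ?_⟩
  have e1 := intervalIntegral.integral_sub hIi.neg hLR
  have e2 := intervalIntegral.integral_add hLi hRi
  simp only [Pi.neg_apply, intervalIntegral.integral_neg, intervalIntegral.integral_div] at e1
  rw [e2, hIe, hLe, hRe] at e1
  exact e1

end TimeIntegral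

lemma MonotoneOn.measurable_indicator {f : ℝ → ℝ} {s : Set ℝ} (hs : s.OrdConnected)
    (hf : MonotoneOn f s) : Measurable (s.indicator f) := by
  have := hs
  have h1 : Measurable (s.domRestrict f) :=
    Monotone.measurable (fun x y hxy => hf x.2 y.2 hxy)
  exact measurable_of_restrict_of_restrict_compl hs.measurableSet
    (by convert h1 using 1; ext x; simp)
    (by convert measurable_const (a := (0 : ℝ)) using 1; ext x; simpa using fun h => absurd h x.2)

lemma BoundedVariationOn.measurable_indicator {f : ℝ → ℝ} {s : Set ℝ} (hs : s.OrdConnected)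
    (hf : BoundedVariationOn f s) : Measurable (s.indicator f) := by
  obtain ⟨p, q, hp, hq, rfl⟩ := hf.locallyBoundedVariationOn.exists_monotoneOn_sub_monotoneOn
  rw [indicator_sub']
  exact (hp.measurable_indicator hs).sub (hq.measurable_indicator hs)

lemma exists_tendsto_mul_indicator {φ f : ℝ → ℝ} {U S : Set ℝ} {c : ℝ} (hU : IsOpen U)
    (hφ : Continuous φ) (hφU : tsupport φ ⊆ U)
    (hf : c ∈ U → ∃ L, Tendsto f (nhdsWithin c S) (nhds L)) :
    ∃ L, Tendsto (fun x => φ x * U.indicator f x) (nhdsWithin c S) (nhds L) := by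
  by_cases hc : c ∈ U
  · obtain ⟨L, hL⟩ := hf hc
    refine ⟨φ c * L, (((hφ.tendsto c).mono_left nhdsWithin_le_nhds).mul hL).congr' ?_⟩
    filter_upwards [mem_nhdsWithin_of_mem_nhds (hU.mem_nhds hc)] with x hx
    rw [indicator_of_mem hx]
  · refine ⟨0, tendsto_const_nhds.congr' ?_⟩
    have h : φ =ᶠ[nhds c] 0 := notMem_tsupport_iff_eventuallyEq.1 fun h => hc (hφU h)
    filter_upwards [mem_nhdsWithin_of_mem_nhds h] with x hx
    simp [show φ x = 0 from hx]

lemma setIntegral_deriv_mul_eq_integral_indicator {ψ f : ℝ → ℝ} {U : Set ℝ}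
    (hU : MeasurableSet U) :
    ∫ x in U, deriv ψ x * f x = ∫ x, deriv ψ x * U.indicator f x := by
  rw [← integral_indicator hU]
  refine integral_congr_ae (Eventually.of_forall fun x => ?_)
  simp only [indicator_mul_right]

lemma tendsto_indicator_Ici_right (c x : ℝ) :
    Tendsto ((Ici c).indicator fun _ => (1 : ℝ)) (nhdsWithin x (Ioi x))
      (nhds ((Ici c).indicator (fun _ => (1 : ℝ)) x)) := by
  refine tendsto_const_nhds.congr' ?_
  rcases le_or_gt c x with h | h
  · filter_upwards [self_mem_nhdsWithin] with y hy
    rw [indicator_of_mem (mem_Ici.2 h), indicator_of_mem (mem_Ici.2 (h.trans (le_of_lt hy)))]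
  · filter_upwards [mem_nhdsWithin_of_mem_nhds (Iio_mem_nhds h)] with y hy
    rw [indicator_of_notMem (by simpa using h), indicator_of_notMem (by simpa using hy)]

lemma tendsto_indicator_Ioi_left (c x : ℝ) :
    Tendsto ((Ioi c).indicator fun _ => (1 : ℝ)) (nhdsWithin x (Iio x))
      (nhds ((Ioi c).indicator (fun _ => (1 : ℝ)) x)) := by
  refine tendsto_const_nhds.congr' ?_
  rcases lt_or_ge c x with h | h
  · filter_upwards [mem_nhdsWithin_of_mem_nhds (Ioi_mem_nhds h)] with y hy
    rw [indicator_of_mem (mem_Ioi.2 h), indicator_of_mem hy]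
  · filter_upwards [self_mem_nhdsWithin] with y hy
    rw [indicator_of_notMem (by simpa using h),
      indicator_of_notMem (by simpa using (le_of_lt hy).trans h)]

section Partition

variable {n : ℕ} {pts : Fin (n + 2) → ℝ}

lemma exists_mem_Ioo_of_ne_nodes {y : ℝ} (h0 : pts 0 < y) (hl : y < pts (Fin.last (n + 1)))
    (hy : y ∉ range pts) : ∃ i : Fin (n + 1), pts i.castSucc < y ∧ y < pts i.succ := by
  by_contra! h
  have key : ∀ j : Fin (n + 2), pts j < y := by
    intro j
    induction j using Fin.induction with
    | zero => exact h0
    | succ i ih => exact lt_of_le_of_ne (h i ih) fun e => hy ⟨_, e⟩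
  exact lt_asymm hl (key _)

lemma sum_mul_step_sub {K : ℝ → ℝ → ℝ} (h1 : ∀ c y, c < y → K c y = 1)
    (h0 : ∀ c y, y < c → K c y = 0) (hpts : StrictMono pts) (τ : Fin (n + 1) → ℝ)
    {y : ℝ} {i : Fin (n + 1)} (hi : pts i.castSucc < y) (hi' : y < pts i.succ) :
    ∑ j, τ j * (K (pts j.castSucc) y - K (pts j.succ) y) = τ i := by
  rw [Finset.sum_eq_single i, h1 _ _ hi, h0 _ _ hi', sub_zero, mul_one]
  · intro j _ hj
    rcases lt_or_gt_of_ne hj with hj | hj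
    · have h2 : pts j.succ ≤ pts i.castSucc := hpts.monotone (by
        rw [Fin.le_def]; simpa using hj)
      have h3 : pts j.castSucc < pts j.succ := hpts (Fin.castSucc_lt_succ)
      rw [h1 _ _ (by linarith), h1 _ _ (by linarith)]; simp
    · have h2 : pts i.succ ≤ pts j.castSucc := hpts.monotone (by
        rw [Fin.le_def]; simpa using hj)
      have h3 : pts j.castSucc < pts j.succ := hpts (Fin.castSucc_lt_succ)
      rw [h0 _ _ (by linarith), h0 _ _ (by linarith)]; simp
  · simp

/-- A function which is constant on each cell of a partition has the expected
precise representative. -/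
lemma half_sum_limits_eq {f : ℝ → ℝ} (hpts : StrictMono pts) (τ : Fin (n + 1) → ℝ)
    (hf : ∀ i, ∀ y ∈ Ioo (pts i.castSucc) (pts i.succ), f y = τ i) {x p m : ℝ}
    (hx : x ∈ Ioo (pts 0) (pts (Fin.last (n + 1))))
    (hp : Tendsto f (nhdsWithin x (Ioi x)) (nhds p))
    (hm : Tendsto f (nhdsWithin x (Iio x)) (nhds m)) :
    (p + m) / 2 = ∑ i, τ i * (halfStep (pts i.castSucc) x - halfStep (pts i.succ) x) := by
  have hev : ∀ᶠ y in nhdsWithin x {x}ᶜ,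
      ∃ i : Fin (n + 1), pts i.castSucc < y ∧ y < pts i.succ := by
    have hfin : (range pts \ {x}).Finite := (finite_range pts).subset sdiff_subset
    have h1 : (range pts \ {x})ᶜ ∈ nhds x := hfin.isClosed.isOpen_compl.mem_nhds (by simp)
    filter_upwards [mem_nhdsWithin_of_mem_nhds h1, self_mem_nhdsWithin,
      mem_nhdsWithin_of_mem_nhds (isOpen_Ioo.mem_nhds hx)] with y hy1 hy2 hy3
    exact exists_mem_Ioo_of_ne_nodes hy3.1 hy3.2 fun h => hy1 ⟨h, hy2⟩
  have hp' : p = ∑ i, τ i * ((Ici (pts i.castSucc)).indicator (fun _ => (1 : ℝ)) x -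
      (Ici (pts i.succ)).indicator (fun _ => (1 : ℝ)) x) := by
    refine tendsto_nhds_unique hp (Tendsto.congr' ?_ (tendsto_finsetSum _ fun i _ =>
      ((tendsto_indicator_Ici_right _ x).sub (tendsto_indicator_Ici_right _ x)).const_mul (τ i)))
    filter_upwards [hev.filter_mono (nhdsWithin_mono x fun y hy => ne_of_gt hy)] with y ⟨i, hi, hi'⟩
    rw [hf i y ⟨hi, hi'⟩]
    exact sum_mul_step_sub (K := fun c => (Ici c).indicator fun _ => (1 : ℝ))
      (fun c y h => indicator_of_mem (mem_Ici.2 h.le) _)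
      (fun c y h => indicator_of_notMem (by simpa using h) _) hpts τ hi hi'
  have hm' : m = ∑ i, τ i * ((Ioi (pts i.castSucc)).indicator (fun _ => (1 : ℝ)) x -
      (Ioi (pts i.succ)).indicator (fun _ => (1 : ℝ)) x) := by
    refine tendsto_nhds_unique hm (Tendsto.congr' ?_ (tendsto_finsetSum _ fun i _ =>
      ((tendsto_indicator_Ioi_left _ x).sub (tendsto_indicator_Ioi_left _ x)).const_mul (τ i)))
    filter_upwards [hev.filter_mono (nhdsWithin_mono x fun y hy => ne_of_lt hy)] with y ⟨i, hi, hi'⟩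
    rw [hf i y ⟨hi, hi'⟩]
    exact sum_mul_step_sub (K := fun c => (Ioi c).indicator fun _ => (1 : ℝ))
      (fun c y h => indicator_of_mem (mem_Ioi.2 h) _)
      (fun c y h => indicator_of_notMem (by simpa using h.le) _) hpts τ hi hi'
  rw [hp', hm', ← Finset.sum_add_distrib, Finset.sum_div]
  refine Finset.sum_congr rfl fun i _ => ?_
  simp only [halfStep]
  ring

end Partition

lemma integrable_mul_halfStep {φ : ℝ → ℝ} (hφ : Continuous φ) (hφc : HasCompactSupport φ)
    (μ : Measure ℝ) [IsFiniteMeasure μ] (c : ℝ) : Integrable (fun x => φ x * halfStep c x) μ :=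
  (hφ.integrable_of_hasCompactSupport hφc).mul_bdd (c := 1)
    (measurable_halfStep c).aestronglyMeasurable
    (Eventually.of_forall fun x => abs_halfStep_le c x)

lemma ite_Ioo_eq_halfStep_sub {c d : ℝ} (h : c < d) (x : ℝ) :
    (if x ∈ Ioo c d then (1 : ℝ) else if x = c ∨ x = d then 1 / 2 else 0) =
      halfStep c x - halfStep d x := by
  rcases lt_trichotomy x c with hc | rfl | hc
  · have hd := hc.trans h
    simp [halfStep_of_gt hc, halfStep_of_gt hd, hc.ne, hd.ne, hc.le]
  · simp [halfStep_of_gt h, halfStep_self]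
  · rcases lt_trichotomy x d with hd | rfl | hd
    · simp [halfStep_of_lt hc, halfStep_of_gt hd, hc, hd]
    · simp only [halfStep_of_lt h, halfStep_self]; norm_num
    · simp [halfStep_of_lt hc, halfStep_of_lt hd, hc.ne', hd.ne', hd.le]

lemma integral_mul_halfStep_diff {φ : ℝ → ℝ} (hφ : Continuous φ) (hφc : HasCompactSupport φ)
    (μ : Measure ℝ) [IsFiniteMeasure μ] (c d : ℝ) :
    ∫ x, φ x * (halfStep c x - halfStep d x) ∂μ =
      (∫ x, φ x * halfStep c x ∂μ) - ∫ x, φ x * halfStep d x ∂μ := by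
  simp only [mul_sub]
  exact integral_sub (integrable_mul_halfStep hφ hφc μ c) (integrable_mul_halfStep hφ hφc μ d)

/-- Coincidence of the two forms of the `x`-derivative term
(Proposition 5.3).  `B(·,t) ∈ BV(]a,b[)`, `B(x,0)=0`,
`(D_t B)(·,t) ∈ BV(]a,b[)` with `|D_t B|` locally bounded, all jump sets
contained in a fixed countable set `N`.  The measures `D_x(D_t B)(·,t)` and
`(D_x B)(·,w)` are encoded as differences `Mp t − Mm t` and `Np w − Nm w` of
finite measures, via integration by parts.  `u ≥ 0` is a piecewise constant
function with nodes `pts` and values `vv`; `Ω_{u,t}` is the set of `x` such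
that `t` lies in the segment with endpoints `0` and `u(x)`, and `χp t`,
`χm t` are the one–sided limits of its indicator, so that
`χ*_{Ω_{u,t}} = (χp + χm)/2`.  The precise representative of the indicator of
`[pts i, pts (i+1)]` is written explicitly. -/
theorem stmt15 (a b : ℝ) (hab : a < b)
    (B DtB Bp Bm DtBp DtBm : ℝ → ℝ → ℝ)
    (hB0 : ∀ x, B x 0 = 0)
    (hBV : ∀ t : ℝ, BoundedVariationOn (fun x => B x t) (Set.Ioo a b))
    (hderiv : ∀ x t : ℝ, HasDerivAt (B x) (DtB x t) t)
    (hDtBV : ∀ t : ℝ, BoundedVariationOn (fun x => DtB x t) (Set.Ioo a b))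
    (hDtbd : ∀ R : ℝ, ∃ C : ℝ, ∀ x ∈ Set.Ioo a b, ∀ t : ℝ, |t| ≤ R → |DtB x t| ≤ C)
    -- one-sided limits in x
    (hBp : ∀ t : ℝ, ∀ x ∈ Set.Ioo a b,
      Filter.Tendsto (fun y => B y t) (nhdsWithin x (Set.Ioi x)) (nhds (Bp x t)))
    (hBm : ∀ t : ℝ, ∀ x ∈ Set.Ioo a b,
      Filter.Tendsto (fun y => B y t) (nhdsWithin x (Set.Iio x)) (nhds (Bm x t)))
    (hDtBp : ∀ t : ℝ, ∀ x ∈ Set.Ioo a b,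
      Filter.Tendsto (fun y => DtB y t) (nhdsWithin x (Set.Ioi x)) (nhds (DtBp x t)))
    (hDtBm : ∀ t : ℝ, ∀ x ∈ Set.Ioo a b,
      Filter.Tendsto (fun y => DtB y t) (nhdsWithin x (Set.Iio x)) (nhds (DtBm x t)))
    -- all jump sets contained in a fixed countable set N
    (N : Set ℝ) (hNc : N.Countable) (hNsub : N ⊆ Set.Ioo a b)
    (hjumpB : ∀ t : ℝ, {x ∈ Set.Ioo a b | Bm x t ≠ Bp x t} ⊆ N)
    (hjumpDtB : ∀ t : ℝ, {x ∈ Set.Ioo a b | DtBm x t ≠ DtBp x t} ⊆ N)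
    -- D_x(D_t B)(·,t) = Mp t − Mm t
    (Mp Mm : ℝ → MeasureTheory.Measure ℝ)
    (hMfin : ∀ t, IsFiniteMeasure (Mp t) ∧ IsFiniteMeasure (Mm t))
    (hM : ∀ t : ℝ, ∀ ψ : ℝ → ℝ, ContDiff ℝ 1 ψ → HasCompactSupport ψ →
      tsupport ψ ⊆ Set.Ioo a b →
      ∫ x in Set.Ioo a b, deriv ψ x * DtB x t =
        -((∫ x, ψ x ∂(Mp t)) - (∫ x, ψ x ∂(Mm t))))
    -- (D_x B)(·,w) = Np w − Nm w
    (Np Nm : ℝ → MeasureTheory.Measure ℝ)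
    (hNfin : ∀ w, IsFiniteMeasure (Np w) ∧ IsFiniteMeasure (Nm w))
    (hNmeas : ∀ w : ℝ, ∀ ψ : ℝ → ℝ, ContDiff ℝ 1 ψ → HasCompactSupport ψ →
      tsupport ψ ⊆ Set.Ioo a b →
      ∫ x in Set.Ioo a b, deriv ψ x * B x w =
        -((∫ x, ψ x ∂(Np w)) - (∫ x, ψ x ∂(Nm w))))
    -- u : nonnegative piecewise constant function
    (u : ℝ → ℝ) (hunn : ∀ x, 0 ≤ u x)
    (n : ℕ) (pts : Fin (n + 2) → ℝ) (hpts : StrictMono pts)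
    (hpts0 : pts 0 = a) (hptsl : pts (Fin.last (n + 1)) = b)
    (vv : Fin (n + 1) → ℝ) (hvv : ∀ i, 0 ≤ vv i)
    (huval : ∀ i : Fin (n + 1), ∀ x : ℝ,
      pts i.castSucc < x → x < pts i.succ → u x = vv i)
    -- Ω_{u,t} and the one-sided limits of its indicator
    (Ω : ℝ → Set ℝ)
    (hΩ : ∀ t : ℝ, Ω t =
      {x ∈ Set.Ioo a b | min 0 (u x) ≤ t ∧ t ≤ max 0 (u x)})
    (χp χm : ℝ → ℝ → ℝ)
    (hχp : ∀ t : ℝ, ∀ x ∈ Set.Ioo a b,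
      Filter.Tendsto (Set.indicator (Ω t) (fun _ => (1:ℝ)))
        (nhdsWithin x (Set.Ioi x)) (nhds (χp t x)))
    (hχm : ∀ t : ℝ, ∀ x ∈ Set.Ioo a b,
      Filter.Tendsto (Set.indicator (Ω t) (fun _ => (1:ℝ)))
        (nhdsWithin x (Set.Iio x)) (nhds (χm t x))) :
    ∀ φ : ℝ → ℝ, ContDiff ℝ 1 φ → HasCompactSupport φ →
      tsupport φ ⊆ Set.Ioo a b →
      (∫ t : ℝ, Real.sign t *
        ((∫ x, ((χp t x + χm t x) / 2) * φ x ∂(Mp t))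
          - (∫ x, ((χp t x + χm t x) / 2) * φ x ∂(Mm t)))) =
      ∑ i : Fin (n + 1),
        ((∫ x, φ x *
            (if x ∈ Set.Ioo (pts i.castSucc) (pts i.succ) then (1:ℝ)
              else if x = pts i.castSucc ∨ x = pts i.succ then 1/2 else 0)
            ∂(Np (vv i)))
          - (∫ x, φ x *
            (if x ∈ Set.Ioo (pts i.castSucc) (pts i.succ) then (1:ℝ)
              else if x = pts i.castSucc ∨ x = pts i.succ then 1/2 else 0)
            ∂(Nm (vv i)))) := by
  intro φ hφ hφc hφU
  have hU : IsOpen (Ioo a b) := isOpen_Ioo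
  have hpts' : ∀ i : Fin (n + 1), pts i.castSucc < pts i.succ := fun i => hpts Fin.castSucc_lt_succ
  have hpairing : ∀ (i : Fin (n + 1)) (j : Fin (n + 2)),
      IntervalIntegrable (fun t => halfStepPairing φ (Mp t) (Mm t) (pts j)) volume 0 (vv i) ∧
        ∫ t in (0 : ℝ)..(vv i), halfStepPairing φ (Mp t) (Mm t) (pts j) =
          halfStepPairing φ (Np (vv i)) (Nm (vv i)) (pts j) := by
    intro i j
    have := (hNfin (vv i)).1
    have := (hNfin (vv i)).2
    choose L hL using fun t => exists_tendsto_mul_indicator (f := fun x => DtB x t)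
      (S := Iio (pts j)) hU hφ.continuous hφU fun hx => ⟨_, hDtBm t _ hx⟩
    choose R hR using fun t => exists_tendsto_mul_indicator (f := fun x => DtB x t)
      (S := Ioi (pts j)) hU hφ.continuous hφU fun hx => ⟨_, hDtBp t _ hx⟩
    obtain ⟨l, hl⟩ := exists_tendsto_mul_indicator (f := fun x => B x (vv i))
      (S := Iio (pts j)) hU hφ.continuous hφU fun hx => ⟨_, hBm (vv i) _ hx⟩
    obtain ⟨r, hr⟩ := exists_tendsto_mul_indicator (f := fun x => B x (vv i))
      (S := Ioi (pts j)) hU hφ.continuous hφU fun hx => ⟨_, hBp (vv i) _ hx⟩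
    refine intervalIntegral_halfStepPairing
      (β := fun t => (Ioo a b).indicator fun x => B x t)
      (d := fun t => (Ioo a b).indicator fun x => DtB x t)
      (fun t => (hBV t).measurable_indicator ordConnected_Ioo) ?_ ?_ ?_ (hvv i) hφ hφc hφU
      hL hR hl hr (fun t => (hMfin t).1) (fun t => (hMfin t).2) ?_ ?_
    · intro t x
      by_cases hx : x ∈ Ioo a b
      · simpa only [indicator_of_mem hx] using hderiv x t
      · simpa only [indicator_of_notMem hx] using hasDerivAt_const t (0 : ℝ)
    · intro x
      simp [hB0]
    · intro R
      obtain ⟨C, hC⟩ := hDtbd R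
      refine ⟨max C 0, fun t x ht => ?_⟩
      by_cases hx : x ∈ Ioo a b
      · simpa only [indicator_of_mem hx] using (hC x hx t ht).trans (le_max_left _ _)
      · simp only [indicator_of_notMem hx, abs_zero, le_max_right]
    · intro t ψ h1 h2 h3
      rw [← hM t ψ h1 h2 h3, setIntegral_deriv_mul_eq_integral_indicator measurableSet_Ioo]
    · intro ψ h1 h2 h3
      rw [← hNmeas (vv i) ψ h1 h2 h3, setIntegral_deriv_mul_eq_integral_indicator measurableSet_Ioo]
  have hzero : ∀ x, x ∉ Ioo a b → φ x = 0 := fun x hx =>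
    image_eq_zero_of_notMem_tsupport fun h => hx (hφU h)
  have hsum : ∀ t, 0 < t → ∀ x, (χp t x + χm t x) / 2 * φ x =
      ∑ i, (if t ≤ vv i then (1 : ℝ) else 0) *
        (φ x * (halfStep (pts i.castSucc) x - halfStep (pts i.succ) x)) := by
    intro t ht x
    by_cases hx : x ∈ Ioo a b
    · have hcell : ∀ i, ∀ y ∈ Ioo (pts i.castSucc) (pts i.succ),
          (Ω t).indicator (fun _ => (1 : ℝ)) y = if t ≤ vv i then (1 : ℝ) else 0 := by
        intro i y hy
        have hyab : y ∈ Ioo a b := by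
          rw [← hpts0, ← hptsl]
          exact ⟨(hpts.monotone (Fin.zero_le _)).trans_lt hy.1,
            hy.2.trans_le (hpts.monotone (Fin.le_last _))⟩
        have : y ∈ Ω t ↔ t ≤ vv i := by
          rw [hΩ]
          simp [hyab.1, hyab.2, huval i y hy.1 hy.2, ht.le, ht.not_ge]
        simp only [indicator_apply, this]
      have hx' : x ∈ Ioo (pts 0) (pts (Fin.last (n + 1))) := by rwa [hpts0, hptsl]
      rw [half_sum_limits_eq hpts _ hcell hx' (hχp t x hx) (hχm t x hx), Finset.sum_mul]
      exact Finset.sum_congr rfl fun i _ => by ring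
    · simp [hzero x hx]
  have hpos : ∀ t, 0 < t → ∀ (μ : Measure ℝ) [IsFiniteMeasure μ],
      ∫ x, (χp t x + χm t x) / 2 * φ x ∂μ = ∑ i, (if t ≤ vv i then (1 : ℝ) else 0) *
        ((∫ x, φ x * halfStep (pts i.castSucc) x ∂μ) -
          ∫ x, φ x * halfStep (pts i.succ) x ∂μ) := by
    intro t ht μ _
    simp only [hsum t ht]
    rw [integral_finsetSum]
    · simp only [integral_const_mul, integral_mul_halfStep_diff hφ.continuous hφc]
    · intro i _
      refine Integrable.const_mul ?_ _
      simp only [mul_sub]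
      exact (integrable_mul_halfStep hφ.continuous hφc μ _).sub
        (integrable_mul_halfStep hφ.continuous hφc μ _)
  have hneg : ∀ t < 0, ∀ x, (χp t x + χm t x) / 2 * φ x = 0 := by
    intro t ht x
    by_cases hx : x ∈ Ioo a b
    · have hempty : Ω t = ∅ := by
        rw [hΩ, eq_empty_iff_forall_notMem]
        rintro y ⟨-, h, -⟩
        rw [min_eq_left (hunn y)] at h
        exact absurd h ht.not_ge
      have hp := hχp t x hx
      have hm := hχm t x hx
      rw [hempty, indicator_empty] at hp hm
      rw [tendsto_nhds_unique hp tendsto_const_nhds, tendsto_nhds_unique hm tendsto_const_nhds]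
      simp
    · simp [hzero x hx]
  have hintegrand : ∀ t, Real.sign t *
      ((∫ x, (χp t x + χm t x) / 2 * φ x ∂(Mp t)) -
        ∫ x, (χp t x + χm t x) / 2 * φ x ∂(Mm t)) =
      ∑ i, (Ioc 0 (vv i)).indicator (fun t => halfStepPairing φ (Mp t) (Mm t) (pts i.castSucc) -
        halfStepPairing φ (Mp t) (Mm t) (pts i.succ)) t := by
    intro t
    have := (hMfin t).1
    have := (hMfin t).2
    rcases lt_trichotomy t 0 with ht | rfl | ht
    · simp [hneg t ht, ht.not_gt]
    · simp
    · rw [Real.sign_of_pos ht, one_mul, hpos t ht, hpos t ht, ← Finset.sum_sub_distrib]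
      refine Finset.sum_congr rfl fun i _ => ?_
      simp only [indicator_apply, mem_Ioc, ht, true_and, halfStepPairing]
      split_ifs <;> ring
  simp only [hintegrand]
  rw [integral_finsetSum]
  · refine Finset.sum_congr rfl fun i _ => ?_
    have := (hNfin (vv i)).1
    have := (hNfin (vv i)).2
    rw [integral_indicator measurableSet_Ioc, ← intervalIntegral.integral_of_le (hvv i),
      intervalIntegral.integral_sub (hpairing i _).1 (hpairing i _).1, (hpairing i _).2,
      (hpairing i _).2]
    simp only [ite_Ioo_eq_halfStep_sub (hpts' i), integral_mul_halfStep_diff hφ.continuous hφc,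
      halfStepPairing]
    ring
  · intro i _
    rw [integrable_indicator_iff measurableSet_Ioc,
      ← intervalIntegrable_iff_integrableOn_Ioc_of_le (hvv i)]
    exact (hpairing i _).1.sub (hpairing i _).1
end
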